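/- arXiv:2508.03335 — 3 statements merged into one kernel-verified Lean document; each statement's English description precedes it below -/
import Mathlib

section
/- For every integer w ≥ 0, every real number α ≥ 3·(3/2)^w, and every tree T with |E(T)| > α, there exists a set W ⊆ V(T) with |W| ≤ w+1 such that for some set C of W-subtrees of T, α < Σ_{T'∈C} |E(T')| ≤ (1 + (2/3)^w)·α. -/
open SimpleGraph

def Contains {V W : Type*} (U : SimpleGraph V) (G : SimpleGraph W) : Prop :=
  ∃ f : G →g U, Function.Injective f

def IsWSubtree {V : Type*} (F : SimpleGraph V) (W : Set V) (H : F.Subgraph) : Prop :=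
  H.coe.IsTree ∧ (∀ w ∈ W, (H.neighborSet w).Subsingleton) ∧
    ∀ H' : F.Subgraph, H ≤ H' → H'.coe.IsTree →
      (∀ w ∈ W, (H'.neighborSet w).Subsingleton) → H' = H

noncomputable def ratio (w : ℕ) : ℝ := (2 + (2/3 : ℝ) ^ w) / (1 + (2/3 : ℝ) ^ w)
noncomputable def alphaF (w p : ℕ) : ℝ := (1 / (1 + (2/3 : ℝ) ^ w)) * ratio w ^ (p - 1)
noncomputable def betaF (w : ℕ) : ℝ := 3 * (3/2 : ℝ) ^ w
noncomputable def gammaF (w p : ℕ) : ℝ := ratio w ^ p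
noncomputable def deltaF (w : ℕ) : ℝ := (2 + (2/3 : ℝ) ^ w) * betaF w
noncomputable def pW (w : ℕ) : ℕ := sInf {p : ℕ | betaF w ≤ alphaF w (p + 1)}

noncomputable def betaK (k w : ℕ) : ℝ := (2 * k + 4) * (3/2 : ℝ) ^ w
noncomputable def deltaK (k w : ℕ) : ℝ := (2 + (2/3 : ℝ) ^ w) * betaK k w
noncomputable def pWK (k w : ℕ) : ℕ := sInf {p : ℕ | betaK k w ≤ alphaF w (p + 1)}

def JVert (a b : ℕ) : ℕ → Type
  | 0 => Fin b
  | m + 1 => Fin a ⊕ (JVert a b m ⊕ JVert a b m)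

def JGraph (a b : ℕ) : (m : ℕ) → SimpleGraph (JVert a b m)
  | 0 => ⊤
  | m + 1 => SimpleGraph.fromRel (fun u v =>
      match u, v with
      | Sum.inl _, _ => True
      | Sum.inr (Sum.inl x), Sum.inr (Sum.inl y) => (JGraph a b m).Adj x y
      | Sum.inr (Sum.inr x), Sum.inr (Sum.inr y) => (JGraph a b m).Adj x y
      | _, _ => False)

noncomputable def GwpVert (w p : ℕ) : Type := JVert (w + 1) ⌈deltaF w⌉₊ (p - pW w)
noncomputable def Gwp (w p : ℕ) : SimpleGraph (GwpVert w p) := JGraph _ _ _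

noncomputable def GkwpVert (k w p : ℕ) : Type := JVert ((k + 1) * (w + 1)) ⌈deltaK k w⌉₊ (p - pWK k w)
noncomputable def Gkwp (k w p : ℕ) : SimpleGraph (GkwpVert k w p) := JGraph _ _ _

structure TreeDecomp {V : Type*} {ι : Type*} (G : SimpleGraph V) (T : SimpleGraph ι) where
  isTree : T.IsTree
  bag : ι → Set V
  bag_connected : ∀ v : V, (T.induce {x | v ∈ bag x}).Connected
  bag_edge : ∀ ⦃u v : V⦄, G.Adj u v → ∃ x, u ∈ bag x ∧ v ∈ bag x

def HasTreewidthLE {V : Type*} (G : SimpleGraph V) (k : ℕ) : Prop :=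
  ∃ (ι : Type) (T : SimpleGraph ι) (td : TreeDecomp G T), ∀ x, (td.bag x).ncard ≤ k + 1

/-- The edge set `S` contains all or none of the edges of `G` at the vertex `x`. -/
def Saturated {V : Type*} (G : SimpleGraph V) (S : Set (Sym2 V)) (x : V) : Prop :=
  ∀ e ∈ G.edgeSet, ∀ f ∈ G.edgeSet, x ∈ e → x ∈ f → e ∈ S → f ∈ S

section Edges

variable {V : Type*} {G : SimpleGraph V} {S S' : Set (Sym2 V)} {x : V}

lemma Saturated.sdiff (h : Saturated G S x) (h' : Saturated G S' x) :
    Saturated G (S \ S') x := fun e he f hf hxe hxf heS =>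
  ⟨h e he f hf hxe hxf heS.1, fun hfS => heS.2 (h' f hf e he hxf hxe hfS)⟩

lemma Saturated.union_of_deleteEdges (h : Saturated G S x)
    (h' : Saturated (G.deleteEdges S) S' x) : Saturated G (S ∪ S') x := by
  intro e he f hf hxe hxf heS
  by_cases hfS : f ∈ S
  · exact Or.inl hfS
  have heS₀ : e ∉ S := fun h₀ => hfS (h e he f hf hxe hxf h₀)
  refine Or.inr (h' e ?_ f ?_ hxe hxf (heS.resolve_left heS₀))
  · rw [edgeSet_deleteEdges]; exact ⟨he, heS₀⟩
  · rw [edgeSet_deleteEdges]; exact ⟨hf, hfS⟩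

/-- The edges of `S` in the component of `u` once the edge `uv` is deleted. -/
def branchEdges (G : SimpleGraph V) (S : Set (Sym2 V)) (u v : V) : Set (Sym2 V) :=
  {f ∈ S | f ≠ s(u, v) ∧ ∀ y ∈ f, (G.deleteEdges {s(u, v)}).Reachable u y}

lemma mem_branchEdges {u v : V} {f : Sym2 V} (hf : f ∈ G.edgeSet) (hxf : x ∈ f) :
    f ∈ branchEdges G S u v ↔
      f ∈ S ∧ f ≠ s(u, v) ∧ (G.deleteEdges {s(u, v)}).Reachable u x := by
  refine ⟨fun h => ⟨h.1, h.2.1, h.2.2 x hxf⟩, fun ⟨h₁, h₂, h₃⟩ => ⟨h₁, h₂, fun y hy => ?_⟩⟩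
  by_cases hxy : x = y
  · exact hxy ▸ h₃
  obtain rfl : f = s(x, y) := (Sym2.mem_and_mem_iff hxy).1 ⟨hxf, hy⟩
  refine h₃.trans (Adj.reachable ?_)
  rw [deleteEdges_adj]
  exact ⟨hf, h₂⟩

lemma saturated_branchEdges (hG : G.IsAcyclic) {u v : V} (huv : G.Adj u v)
    (hS : ∀ x ≠ v, Saturated G S x) (hx : x ≠ u) : Saturated G (branchEdges G S u v) x := by
  intro e he f hf hxe hxf heA
  rw [mem_branchEdges he hxe] at heA
  rw [mem_branchEdges hf hxf]
  obtain ⟨heS, -, hr⟩ := heA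
  have hxv : x ≠ v := by
    rintro rfl
    exact isBridge_iff.1 (isAcyclic_iff_forall_adj_isBridge.1 hG huv) hr
  refine ⟨hS x hxv e he f hf hxe hxf heS, ?_, hr⟩
  rintro rfl
  rcases Sym2.mem_iff.1 hxf with h | h
  exacts [hx h, hxv h]

lemma saturated_insert_branchEdges (hG : G.IsAcyclic) {u v : V} (huv : G.Adj u v)
    (hS : ∀ x ≠ v, Saturated G S x) (huvS : s(u, v) ∈ S) (hx : x ≠ v) :
    Saturated G (insert s(u, v) (branchEdges G S u v)) x := by
  by_cases hxu : x = u
  · subst hxu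
    intro e he f hf hxe hxf _
    by_cases hfe : f = s(x, v)
    · exact Or.inl hfe
    · refine Or.inr ((mem_branchEdges hf hxf).2 ⟨?_, hfe, Reachable.refl _⟩)
      exact hS x hx _ huv f hf (Sym2.mem_mk_left _ _) hxf huvS
  · intro e he f hf hxe hxf heA
    have hne : e ≠ s(u, v) := by
      rintro rfl
      rcases Sym2.mem_iff.1 hxe with h | h
      exacts [hxu h, hx h]
    exact Or.inr (saturated_branchEdges hG huv hS hxu e he f hf hxe hxf (heA.resolve_left hne))

lemma exists_saturated_off_vertex [Finite V] (hG : G.IsAcyclic) {α : ℝ} (hα : 0 ≤ α)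
    (hE : α < G.edgeSet.ncard) :
    ∃ S ⊆ G.edgeSet, ∃ v, (∀ x ≠ v, Saturated G S x) ∧
      α < S.ncard ∧ (S.ncard : ℝ) ≤ α + max 1 α := by
  have hmem : ∀ S ⊆ G.edgeSet, α < S.ncard → ∃ u v, s(u, v) ∈ S := by
    intro S _ h
    have : S.Nonempty := by
      rw [← Set.ncard_pos]
      exact_mod_cast hα.trans_lt h
    obtain ⟨e, he⟩ := this
    induction e with
    | _ u v => exact ⟨u, v, he⟩
  obtain ⟨u₀, -, -⟩ := hmem _ subset_rfl hE
  let P : Set (Sym2 V) → Prop := fun S =>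
    S ⊆ G.edgeSet ∧ α < S.ncard ∧ ∃ v, ∀ x ≠ v, Saturated G S x
  have hP : {S | P S}.Nonempty :=
    ⟨G.edgeSet, subset_rfl, hE, u₀, fun x _ e he f hf _ _ _ => hf⟩
  obtain ⟨S, ⟨hSG, hSα, hSv⟩, hmin⟩ := (Set.toFinite {S | P S}).exists_minimal hP
  have hmin' : ∀ A ⊂ S, (∃ v, ∀ x ≠ v, Saturated G A x) → (A.ncard : ℝ) ≤ α := by
    intro A hA hv
    by_contra! hlt
    exact hA.2 (hmin ⟨hA.1.trans hSG, hlt, hv⟩ hA.1)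
  obtain ⟨u, v, huvS, hv⟩ : ∃ u v, s(u, v) ∈ S ∧ ∀ x ≠ v, Saturated G S x := by
    obtain ⟨v, hv⟩ := hSv
    by_cases h : ∃ u, s(u, v) ∈ S
    · obtain ⟨u, hu⟩ := h
      exact ⟨u, v, hu, hv⟩
    · obtain ⟨u, v', huv⟩ := hmem S hSG hSα
      refine ⟨u, v', huv, fun x _ => ?_⟩
      by_cases hxv : x = v
      · subst hxv
        intro e _ f _ hxe _ heS
        obtain ⟨y, rfl⟩ := hxe
        exact (h ⟨y, Sym2.eq_swap ▸ heS⟩).elim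
      · exact hv x hxv
  refine ⟨S, hSG, v, hv, hSα, ?_⟩
  have huv : G.Adj u v := hSG huvS
  set A := branchEdges G S u v
  have hAS : A ⊆ S := fun f hf => hf.1
  have heA : s(u, v) ∉ A := fun h => h.2.1 rfl
  have hBS : insert s(u, v) A ⊆ S := Set.insert_subset huvS hAS
  have hA : (A.ncard : ℝ) ≤ α :=
    hmin' A ⟨hAS, fun h => heA (h huvS)⟩ ⟨u, fun x hx => saturated_branchEdges hG huv hv hx⟩
  have hB : ((insert s(u, v) A).ncard : ℝ) = A.ncard + 1 := by
    rw [Set.ncard_insert_of_notMem heA]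
    push_cast
    rfl
  have hsat : ∀ x ≠ v, Saturated G (insert s(u, v) A) x :=
    fun x hx => saturated_insert_branchEdges hG huv hv huvS hx
  by_cases hSB : S ⊆ insert s(u, v) A
  · rw [hSB.antisymm hBS, hB]
    linarith [le_max_left 1 α]
  · have h₁ := hmin' _ ⟨hBS, hSB⟩ ⟨v, hsat⟩
    have h₂ := hmin' (S \ insert s(u, v) A)
      ⟨Set.sdiff_subset, fun h => (h huvS).2 (Set.mem_insert _ _)⟩
      ⟨v, fun x hx => (hv x hx).sdiff (hsat x hx)⟩
    have h₃ : ((S \ insert s(u, v) A).ncard : ℝ) + (insert s(u, v) A).ncard = S.ncard := by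
      exact_mod_cast Set.ncard_sdiff_add_ncard_of_subset hBS
    linarith [le_max_right 1 α]

lemma exists_saturated_off_finset [Finite V] (w : ℕ) (hG : G.IsAcyclic) {α : ℝ} (hα : 0 ≤ α)
    (hE : α < G.edgeSet.ncard) :
    ∃ S ⊆ G.edgeSet, ∃ W : Finset V, W.card ≤ w + 1 ∧ (∀ x ∉ W, Saturated G S x) ∧
      α < S.ncard ∧ (S.ncard : ℝ) ≤ α + max 3 ((2 / 3) ^ w * α) := by
  classical
  induction w generalizing G α with
  | zero =>
    obtain ⟨S, hSG, v, hv, h₁, h₂⟩ := exists_saturated_off_vertex hG hα hE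
    refine ⟨S, hSG, {v}, by simp, fun x hx => hv x (by simpa using hx), h₁, h₂.trans ?_⟩
    rw [pow_zero, one_mul]
    gcongr
    norm_num
  | succ w ih =>
    by_cases hα3 : α ≤ 3
    · obtain ⟨S, hSG, v, hv, h₁, h₂⟩ := exists_saturated_off_vertex hG hα hE
      refine ⟨S, hSG, {v}, by simp, fun x hx => hv x (by simpa using hx), h₁, h₂.trans ?_⟩
      have : max 1 α ≤ 3 := max_le (by norm_num) hα3
      linarith [le_max_left 3 ((2 / 3 : ℝ) ^ (w + 1) * α)]
    · obtain ⟨S, hSG, v, hv, h₁, h₂⟩ :=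
        exists_saturated_off_vertex hG (α := α / 3) (by linarith) (by linarith)
      rw [max_eq_right (by linarith)] at h₂
      have hcard : ((G.edgeSet \ S).ncard : ℝ) + S.ncard = G.edgeSet.ncard := by
        exact_mod_cast Set.ncard_sdiff_add_ncard_of_subset hSG
      obtain ⟨S', hSG', W, hW, hsat, h₁', h₂'⟩ :=
        ih (G := G.deleteEdges S) (α := α - S.ncard) (hG.anti (deleteEdges_le S))
          (by linarith) (by rw [edgeSet_deleteEdges]; linarith)
      rw [edgeSet_deleteEdges] at hSG'
      have hunion : ((S ∪ S').ncard : ℝ) = S.ncard + S'.ncard := by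
        exact_mod_cast Set.ncard_union_eq
          (Set.disjoint_left.2 fun e he he' => (hSG' he').2 he)
      refine ⟨S ∪ S', Set.union_subset hSG (hSG'.trans Set.sdiff_subset), insert v W,
        (Finset.card_insert_le _ _).trans (by omega), fun x hx => ?_, by linarith, ?_⟩
      · rw [Finset.mem_insert, not_or] at hx
        exact (hv x hx.1).union_of_deleteEdges (hsat x hx.2)
      · have : max 3 ((2 / 3 : ℝ) ^ w * (α - S.ncard)) ≤ max 3 ((2 / 3) ^ (w + 1) * α) := by
          rw [pow_succ, mul_assoc]
          gcongr
          linarith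
        linarith

end Edges

section Subtrees

variable {V : Type*} {T : SimpleGraph V} {W : Set V} {H H₁ H₂ : T.Subgraph}

lemma SimpleGraph.IsAcyclic.subgraph_coe (hT : T.IsAcyclic) (H : T.Subgraph) :
    H.coe.IsAcyclic :=
  hT.comap H.hom Subgraph.hom_injective

lemma exists_adj_adj_of_connected (hT : T.IsAcyclic) (h₁ : H₁.Connected) (h₂ : H₂.Connected) {a z : V}
    (ha₁ : a ∈ H₁.verts) (hz₁ : z ∈ H₁.verts) (ha₂ : a ∈ H₂.verts) (hz₂ : z ∈ H₂.verts)
    (haz : a ≠ z) : ∃ b, H₁.Adj a b ∧ H₂.Adj a b := by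
  obtain ⟨p₁, hp₁⟩ := (h₁.coe.preconnected ⟨a, ha₁⟩ ⟨z, hz₁⟩).exists_isPath
  obtain ⟨p₂, hp₂⟩ := (h₂.coe.preconnected ⟨a, ha₂⟩ ⟨z, hz₂⟩).exists_isPath
  have h := congrArg Subtype.val ((hT.subsingleton_path a z).elim
    ⟨p₁.map H₁.hom, hp₁.map Subgraph.hom_injective⟩
    ⟨p₂.map H₂.hom, hp₂.map Subgraph.hom_injective⟩)
  cases p₁ with
  | nil => exact (haz rfl).elim
  | cons hb₁ q₁ =>
    cases p₂ with
    | nil => exact (haz rfl).elim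
    | cons hb₂ q₂ =>
      rename_i b₁ b₂
      have hb : (b₁ : V) = b₂ := (Walk.cons.inj h).1
      exact ⟨b₁, hb₁, hb ▸ hb₂⟩

lemma IsWSubtree.eq_of_mem_edgeSet (hT : T.IsAcyclic) (h₁ : IsWSubtree T W H₁)
    (h₂ : IsWSubtree T W H₂) {e : Sym2 V} (he₁ : e ∈ H₁.edgeSet) (he₂ : e ∈ H₂.edgeSet) :
    H₁ = H₂ := by
  induction e with
  | _ x y =>
  have hxy : x ≠ y := (H₁.adj_sub he₁).ne
  have hc₁ : H₁.Connected := ⟨h₁.1.connected⟩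
  have hc₂ : H₂.Connected := ⟨h₂.1.connected⟩
  have hne : (H₁ ⊓ H₂).verts.Nonempty := ⟨x, H₁.edge_vert he₁, H₂.edge_vert he₂⟩
  have htree : (H₁ ⊔ H₂).coe.IsTree := ⟨(Subgraph.connected_sup hc₁.preconnected hc₂.preconnected hne).coe, hT.subgraph_coe _⟩
  have hkey : ∀ w ∈ W, ∀ a b, H₁.Adj w a → H₂.Adj w b → a = b := by
    intro w hw a b ha hb
    obtain ⟨c, hc₁, hc₂⟩ : ∃ c, H₁.Adj w c ∧ H₂.Adj w c := by
      by_cases hwx : w = x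
      · exact ⟨y, hwx ▸ he₁, hwx ▸ he₂⟩
      · exact exists_adj_adj_of_connected hT hc₁ hc₂ (H₁.edge_vert ha) (H₁.edge_vert he₁)
          (H₂.edge_vert hb) (H₂.edge_vert he₂) hwx
    exact (h₁.2.1 w hw ha hc₁).trans (h₂.2.1 w hw hc₂ hb)
  have hleaf : ∀ w ∈ W, ((H₁ ⊔ H₂).neighborSet w).Subsingleton := by
    rintro w hw a (ha | ha) b (hb | hb)
    · exact h₁.2.1 w hw ha hb
    · exact hkey w hw a b ha hb
    · exact (hkey w hw b a hb ha).symm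
    · exact h₂.2.1 w hw ha hb
  rw [← h₁.2.2 _ le_sup_left htree hleaf]
  exact h₂.2.2 _ le_sup_right htree hleaf

lemma exists_isWSubtree_mem_edgeSet [Finite V] (hT : T.IsAcyclic) (W : Set V) {e : Sym2 V}
    (he : e ∈ T.edgeSet) : ∃ H, IsWSubtree T W H ∧ e ∈ H.edgeSet := by
  induction e with
  | _ x y =>
  have hxy : T.Adj x y := he
  let P : T.Subgraph → Prop := fun H =>
    H.coe.IsTree ∧ ∀ w ∈ W, (H.neighborSet w).Subsingleton
  have h₀ : P (T.subgraphOfAdj hxy) := by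
    refine ⟨⟨(Subgraph.subgraphOfAdj_connected hxy).coe, hT.subgraph_coe _⟩, ?_⟩
    intro w _ a ha b hb
    have hne := hxy.ne
    simp only [Subgraph.mem_neighborSet, subgraphOfAdj_adj, Sym2.eq_iff] at ha hb
    grind
  obtain ⟨H, hle, hH⟩ := (Set.toFinite {H | P H}).exists_le_maximal h₀
  refine ⟨H, ⟨hH.1.1, hH.1.2, fun H' hHH' ht hl => (hH.2 ⟨ht, hl⟩ hHH').antisymm hHH'⟩, ?_⟩
  exact Subgraph.edgeSet_mono hle (by simp)

lemma IsWSubtree.edgeSet_subset (hH : IsWSubtree T W H) {S : Set (Sym2 V)}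
    (hS : ∀ x ∉ W, Saturated T S x) {e : Sym2 V} (he : e ∈ H.edgeSet) (heS : e ∈ S) :
    H.edgeSet ⊆ S := by
  have hstep : ∀ x y, H.Adj x y → s(x, y) ∈ S → ∀ z, H.Adj x z → s(x, z) ∈ S := by
    intro x y hxy hS' z hxz
    by_cases hx : x ∈ W
    · exact hH.2.1 x hx hxy hxz ▸ hS'
    · exact hS x hx _ hxy.adj_sub _ hxz.adj_sub (Sym2.mem_mk_left _ _) (Sym2.mem_mk_left _ _) hS'
  induction e with
  | _ x y =>
  intro f hf
  induction f with
  | _ a b =>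
  have hwalk : ∀ (c d : H.verts) (_ : H.coe.Walk c d),
      (∀ z, H.Adj c z → s((c : V), z) ∈ S) → ∀ z, H.Adj d z → s((d : V), z) ∈ S := by
    intro c d p
    induction p with
    | nil => exact id
    | cons h p ih =>
      intro hc
      have h' := H.coe_adj_sub _ _ h
      refine ih (hstep _ _ (Subgraph.Adj.symm h) ?_)
      rw [Sym2.eq_swap]
      exact hc _ h
  obtain ⟨p⟩ := hH.1.connected.preconnected ⟨x, H.edge_vert he⟩ ⟨a, H.edge_vert hf⟩
  exact hwalk _ _ p (hstep x y he heS) b hf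

lemma exists_finset_isWSubtree [Finite V] (hT : T.IsAcyclic) {S : Set (Sym2 V)}
    (hST : S ⊆ T.edgeSet) (hS : ∀ x ∉ W, Saturated T S x) :
    ∃ C : Finset T.Subgraph, (∀ H ∈ C, IsWSubtree T W H) ∧
      ∑ H ∈ C, H.edgeSet.ncard = S.ncard := by
  have hfin : {H : T.Subgraph | IsWSubtree T W H ∧ ∃ e ∈ S, e ∈ H.edgeSet}.Finite :=
    Set.toFinite _
  refine ⟨hfin.toFinset, fun H hH => (hfin.mem_toFinset.1 hH).1, ?_⟩
  rw [← finsum_mem_eq_finite_toFinset_sum _ hfin,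
    ← hfin.ncard_biUnion (fun _ _ => Set.toFinite _)]
  · congr 1
    ext e
    simp only [Set.mem_iUnion, Set.mem_ofPred_eq, exists_prop]
    constructor
    · rintro ⟨H, ⟨hH, f, hfS, hf⟩, he⟩
      exact hH.edgeSet_subset hS hf hfS he
    · intro he
      obtain ⟨H, hH, heH⟩ := exists_isWSubtree_mem_edgeSet hT W (hST he)
      exact ⟨H, ⟨hH, e, he, heH⟩, heH⟩
  · intro H₁ h₁ H₂ h₂ hne
    exact Set.disjoint_left.2 fun e he₁ he₂ => hne (h₁.1.eq_of_mem_edgeSet hT h₂.1 he₁ he₂)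

end Subtrees

theorem statement_1 (w : ℕ) (α : ℝ) (hα : 3 * (3/2 : ℝ) ^ w ≤ α)
    {V : Type} [Fintype V] (T : SimpleGraph V) (hT : T.IsTree)
    (hE : α < (T.edgeSet.ncard : ℝ)) :
    ∃ W : Finset V, W.card ≤ w + 1 ∧
      ∃ C : Finset T.Subgraph,
        (∀ H ∈ C, IsWSubtree T (↑W) H) ∧
        α < ∑ H ∈ C, ((H.edgeSet.ncard : ℝ)) ∧
        ∑ H ∈ C, ((H.edgeSet.ncard : ℝ)) ≤ (1 + (2/3 : ℝ) ^ w) * α := by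
  obtain ⟨S, hST, W, hW, hsat, h₁, h₂⟩ :=
    exists_saturated_off_finset w hT.isAcyclic ((by positivity : (0 : ℝ) ≤ _).trans hα) hE
  obtain ⟨C, hC, hsum⟩ := exists_finset_isWSubtree (W := ↑W) hT.isAcyclic hST
    (fun x hx => hsat x (by simpa using hx))
  have h₃ : (3 : ℝ) ≤ (2 / 3) ^ w * α := by
    calc (3 : ℝ) = (2 / 3) ^ w * (3 * (3 / 2) ^ w) := by
          rw [mul_left_comm, ← mul_pow]
          norm_num
      _ ≤ (2 / 3) ^ w * α := by gcongr
  rw [max_eq_right h₃] at h₂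
  refine ⟨W, hW, C, hC, ?_⟩
  rw [← Nat.cast_sum, hsum]
  exact ⟨h₁, by linarith⟩
end

section
/- There exist constants C > 0 and N such that for every integer n ≥ N there is a graph U with at most 20n vertices and at most 20·n·(log₂ n)·(log_{3/2} log₂ n) + C·n·(ln n) edges such that U contains every tree on n vertices. -/
open SimpleGraph

/-- No edge of `G` joins a vertex of `X` to a vertex of `Y`. -/
def NoEdges {V : Type*} (G : SimpleGraph V) (X Y : Finset V) : Prop :=
  ∀ x ∈ X, ∀ y ∈ Y, ¬ G.Adj x y

theorem NoEdges.symm {V : Type*} {G : SimpleGraph V} {X Y : Finset V}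
    (h : NoEdges G X Y) : NoEdges G Y X :=
  fun x hx y hy hxy => h y hy x hx hxy.symm

/-- `X` has no nontrivial partition into two parts without edges between them. -/
def Indecomposable {V : Type*} [DecidableEq V] (G : SimpleGraph V) (X : Finset V) : Prop :=
  ∀ K ⊆ X, K.Nonempty → NoEdges G K (X \ K) → K = X

section Separators

variable {V : Type*} [DecidableEq V] {G : SimpleGraph V}

theorem Indecomposable.exists_walk {X : Finset V} (hX : Indecomposable G X) {x y : V}
    (hx : x ∈ X) (hy : y ∈ X) : ∃ p : G.Walk x y, ∀ z ∈ p.support, z ∈ X := by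
  classical
  have hK := hX (X.filter fun y => ∃ p : G.Walk x y, ∀ z ∈ p.support, z ∈ X)
    (Finset.filter_subset _ _) ⟨x, by
      simp only [Finset.mem_filter, hx, true_and]
      exact ⟨.nil, by simpa using hx⟩⟩ (by
      intro u hu v hv huv
      simp only [Finset.mem_filter, Finset.mem_sdiff, not_and, not_exists] at hu hv
      obtain ⟨p, hp⟩ := hu.2
      refine hv.2 hv.1 (p.concat huv) fun z hz => ?_
      rw [SimpleGraph.Walk.support_concat] at hz
      simp only [List.mem_append, List.mem_singleton] at hz
      rcases hz with hz | rfl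
      exacts [hp z hz, hv.1])
  rw [← hK] at hy
  exact (Finset.mem_filter.mp hy).2

/-- In a forest, a vertex outside an indecomposable set has at most one neighbour in it. -/
theorem Indecomposable.neighbor_unique (hG : G.IsAcyclic) {X : Finset V}
    (hX : Indecomposable G X) {v x y : V} (hv : v ∉ X) (hx : x ∈ X) (hy : y ∈ X)
    (hvx : G.Adj v x) (hvy : G.Adj v y) : x = y := by
  by_contra hne
  obtain ⟨p, hp⟩ := hX.exists_walk hx hy
  have hq : (SimpleGraph.Walk.cons hvx.symm (.cons hvy .nil)).IsPath := by
    simp [SimpleGraph.Walk.cons_isPath_iff, hvx.ne', hvy.ne, hne]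
  have h : SimpleGraph.Walk.cons hvx.symm (.cons hvy .nil) = p.bypass :=
    congrArg Subtype.val
      ((hG.subsingleton_path x y).elim ⟨_, hq⟩ ⟨p.bypass, p.bypass_isPath⟩)
  refine hv (hp v (p.support_bypass_subset_support ?_))
  rw [← h]
  simp

/-- Every nonempty set of vertices of a forest has a centroid. -/
theorem exists_centroid (hG : G.IsAcyclic) {R : Finset V} (hR : R.Nonempty) :
    ∃ v ∈ R, ∀ X ⊆ R.erase v, NoEdges G X (R.erase v \ X) → Indecomposable G X →
      2 * X.card ≤ R.card := by
  by_contra! h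
  have key : ∀ k, ∀ v ∈ R, ∀ X ⊆ R.erase v, NoEdges G X (R.erase v \ X) →
      Indecomposable G X → R.card < 2 * X.card → X.card = k → False := by
    intro k
    induction k using Nat.strong_induction_on with
    | _ k ih =>
      intro v hv X hXR hX hXi hc hk
      have hvX : v ∉ X := fun h => by simpa using hXR h
      obtain ⟨u, hu, hvu⟩ : ∃ u ∈ X, ∀ x ∈ X, G.Adj v x → x = u := by
        by_cases hex : ∃ u ∈ X, G.Adj v u
        · obtain ⟨u, hu, hvu⟩ := hex
          exact ⟨u, hu, fun x hx hvx => hXi.neighbor_unique hG hvX hx hu hvx hvu⟩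
        · push Not at hex
          obtain ⟨u, hu⟩ : X.Nonempty := Finset.card_pos.mp (by omega)
          exact ⟨u, hu, fun x hx hvx => absurd hvx (hex x hx)⟩
      have huR : u ∈ R := Finset.mem_of_mem_erase (hXR hu)
      obtain ⟨Y, hYR, hY, hYi, hYc⟩ := h u huR
      have hne : (Y ∩ X).Nonempty := by
        by_contra hemp
        have hd : Disjoint Y X :=
          Finset.disjoint_iff_inter_eq_empty.mpr (Finset.not_nonempty_iff_eq_empty.mp hemp)
        have h1 : Y ∪ X ⊆ R := Finset.union_subset (hYR.trans (Finset.erase_subset _ _))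
          (hXR.trans (Finset.erase_subset _ _))
        have h2 := Finset.card_le_card h1
        rw [Finset.card_union_of_disjoint hd] at h2
        omega
      have hYX := hYi (Y ∩ X) Finset.inter_subset_left hne (by
        intro x hx y hy hxy
        simp only [Finset.mem_inter, Finset.mem_sdiff, not_and] at hx hy
        have hyR := Finset.mem_of_mem_erase (hYR hy.1)
        by_cases hyv : y = v
        · subst hyv
          have := hvu x hx.2 hxy.symm
          subst this
          simpa using hYR hx.1
        · exact hX x hx.2 y (by simp [hyv, hyR, hy.2 hy.1]) hxy)
      have hss : Y ⊂ X := by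
        refine (Finset.ssubset_iff_of_subset (Finset.inter_eq_left.mp hYX)).mpr ⟨u, hu, ?_⟩
        exact fun h => by simpa using hYR h
      exact ih Y.card (hk ▸ Finset.card_lt_card hss) u huR Y hYR hY hYi hYc rfl
  obtain ⟨v, hv⟩ := hR
  obtain ⟨X, h1, h2, h3, h4⟩ := h v hv
  exact key _ v hv X h1 h2 h3 h4 rfl

/-- The pieces of a vertex set can be distributed over two bins of capacity `n / 2` so that
at most one indecomposable piece remains. -/
theorem exists_distribution (G : SimpleGraph V) (n : ℕ) (Q : Finset V) (a b : ℕ)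
    (ha : 2 * a ≤ n) (hb : 2 * b ≤ n) (hab : a + b + Q.card ≤ n) :
    ∃ X Y Z : Finset V, X ∪ Y ∪ Z = Q ∧ X.card + Y.card + Z.card ≤ Q.card ∧
      2 * (a + X.card) ≤ n ∧ 2 * (b + Y.card) ≤ n ∧
      NoEdges G X Y ∧ NoEdges G X Z ∧ NoEdges G Y Z ∧ Indecomposable G Z := by
  induction hq : Q.card using Nat.strong_induction_on generalizing Q a b with
  | _ q ih =>
    by_cases hQ : Indecomposable G Q
    · exact ⟨∅, ∅, Q, by simp, by simp [hq], by simpa, by simpa, by simp [NoEdges],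
        by simp [NoEdges], by simp [NoEdges], hQ⟩
    obtain ⟨K, hKQ, hK, hKe, hKc⟩ : ∃ K ⊆ Q, K.Nonempty ∧ NoEdges G K (Q \ K) ∧
        2 * K.card ≤ Q.card := by
      simp only [Indecomposable, not_forall] at hQ
      obtain ⟨K, hKQ, hK, hKe, hne⟩ := hQ
      have hc := Finset.card_sdiff_add_card_eq_card hKQ
      by_cases h2 : 2 * K.card ≤ Q.card
      · exact ⟨K, hKQ, hK, hKe, h2⟩
      · refine ⟨Q \ K, Finset.sdiff_subset, ?_, ?_, by omega⟩
        · exact Finset.sdiff_nonempty.mpr fun h => hne (hKQ.antisymm h)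
        · rw [Finset.sdiff_sdiff_eq_self hKQ]
          exact hKe.symm
    have hc := Finset.card_sdiff_add_card_eq_card hKQ
    have hpos := hK.card_pos
    by_cases hfit : 2 * (a + K.card) ≤ n
    · obtain ⟨X, Y, Z, hu, hcard, hX, hY, hXY, hXZ, hYZ, hZ⟩ :=
        ih (Q \ K).card (by omega) (Q \ K) (a + K.card) b hfit hb (by omega) rfl
      have := Finset.card_union_le K X
      refine ⟨K ∪ X, Y, Z, ?_, by omega, by omega, hY, ?_, ?_, hYZ, hZ⟩
      · rw [Finset.union_assoc, Finset.union_assoc, ← Finset.union_assoc X, hu,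
          Finset.union_sdiff_of_subset hKQ]
      all_goals
        intro x hx y hy
        have hyQ : y ∈ Q \ K := by rw [← hu]; simp [hy]
        rcases Finset.mem_union.mp hx with hx | hx
        · exact hKe x hx y hyQ
        · first | exact hXY x hx y hy | exact hXZ x hx y hy
    · obtain ⟨X, Y, Z, hu, hcard, hX, hY, hXY, hXZ, hYZ, hZ⟩ :=
        ih (Q \ K).card (by omega) (Q \ K) a (b + K.card) ha (by omega) (by omega) rfl
      have := Finset.card_union_le K Y
      refine ⟨X, K ∪ Y, Z, ?_, by omega, hX, by omega, ?_, hXZ, ?_, hZ⟩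
      · rw [Finset.union_left_comm, Finset.union_assoc, hu, Finset.union_sdiff_of_subset hKQ]
      · intro x hx y hy
        have hxQ : x ∈ Q \ K := by rw [← hu]; simp [hx]
        rcases Finset.mem_union.mp hy with hy | hy
        · exact hKe.symm x hxQ y hy
        · exact hXY x hx y hy
      · intro x hx y hy
        have hyQ : y ∈ Q \ K := by rw [← hu]; simp [hy]
        rcases Finset.mem_union.mp hx with hx | hx
        · exact hKe x hx y hyQ
        · exact hYZ x hx y hy

/-- Removing `w` vertices from a forest leaves two halves and a remainder which is at most a
`2⁻ʷ`-fraction of the whole. -/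
theorem exists_partial_separator (hG : G.IsAcyclic) (R : Finset V) (w : ℕ) :
    ∃ S A B Z : Finset V, R ⊆ S ∪ A ∪ B ∪ Z ∧ S.card ≤ w ∧
      2 * A.card ≤ R.card ∧ 2 * B.card ≤ R.card ∧ A.card + B.card + Z.card ≤ R.card ∧
      2 ^ w * Z.card ≤ R.card ∧ NoEdges G A B ∧ NoEdges G A Z ∧ NoEdges G B Z := by
  induction w with
  | zero =>
    exact ⟨∅, ∅, ∅, R, by simp, by simp, by simp, by simp, by simp, by simp,
      by simp [NoEdges], by simp [NoEdges], by simp [NoEdges]⟩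
  | succ w ih =>
    obtain ⟨S, A, B, Z, hcov, hS, hA, hB, hsum, hZ, hAB, hAZ, hBZ⟩ := ih
    rcases Z.eq_empty_or_nonempty with rfl | hne
    · exact ⟨S, A, B, ∅, hcov, by omega, hA, hB, hsum, by simp, hAB, hAZ, hBZ⟩
    obtain ⟨v, hv, hcen⟩ := exists_centroid hG hne
    have hvc := Finset.card_erase_add_one hv
    obtain ⟨X, Y, Z', hu, hcard, hX, hY, hXY, hXZ, hYZ, hZi⟩ :=
      exists_distribution G R.card (Z.erase v) A.card B.card hA hB (by omega)
    have hmem : ∀ x, x ∈ Z ↔ x = v ∨ x ∈ X ∨ x ∈ Y ∨ x ∈ Z' := by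
      intro x
      have h1 : x ∈ X ∪ Y ∪ Z' ↔ x ∈ Z.erase v := by rw [hu]
      simp only [Finset.mem_union, Finset.mem_erase] at h1
      by_cases hxv : x = v
      · simp [hxv, hv]
      · tauto
    have hZ' := hcen Z' (by rw [← hu]; exact Finset.subset_union_right) (by
      intro x hx y hy hxy
      rw [← hu] at hy
      simp only [Finset.mem_sdiff, Finset.mem_union] at hy
      rcases hy with ⟨(hy | hy) | hy, hn⟩
      exacts [hXZ y hy x hx hxy.symm, hYZ y hy x hx hxy.symm, hn hy]) hZi
    have hSc := Finset.card_insert_le v S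
    have hAX := Finset.card_union_le A X
    have hBY := Finset.card_union_le B Y
    refine ⟨insert v S, A ∪ X, B ∪ Y, Z', ?_, by omega, by omega, by omega, by omega, ?_,
      ?_, ?_, ?_⟩
    · intro x hx
      have := hcov hx
      simp only [Finset.mem_union, Finset.mem_insert, hmem] at this ⊢
      tauto
    · calc 2 ^ (w + 1) * Z'.card = 2 ^ w * (2 * Z'.card) := by ring
        _ ≤ 2 ^ w * Z.card := Nat.mul_le_mul_left _ hZ'
        _ ≤ R.card := hZ
    · intro x hx y hy hxy
      rcases Finset.mem_union.mp hx with hx | hx <;> rcases Finset.mem_union.mp hy with hy | hy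
      · exact hAB x hx y hy hxy
      · exact hAZ x hx y ((hmem y).2 (by tauto)) hxy
      · exact hBZ y hy x ((hmem x).2 (by tauto)) hxy.symm
      · exact hXY x hx y hy hxy
    · intro x hx y hy hxy
      rcases Finset.mem_union.mp hx with hx | hx
      · exact hAZ x hx y ((hmem y).2 (by tauto)) hxy
      · exact hXZ x hx y hy hxy
    · intro x hx y hy hxy
      rcases Finset.mem_union.mp hx with hx | hx
      · exact hBZ x hx y ((hmem y).2 (by tauto)) hxy
      · exact hYZ x hx y hy hxy

/-- A forest has a separator of `w` vertices into two parts with relative excess `2⁻ʷ`. -/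
theorem exists_balanced_separator (hG : G.IsAcyclic) (R : Finset V) (w : ℕ) :
    ∃ S A B : Finset V, R ⊆ S ∪ A ∪ B ∧ S.card ≤ w ∧
      2 * 2 ^ w * A.card ≤ (2 ^ w + 1) * R.card ∧
      2 * 2 ^ w * B.card ≤ (2 ^ w + 1) * R.card ∧ NoEdges G A B := by
  obtain ⟨S, A, B, Z, hcov, hS, hA, hB, hsum, hZ, hAB, hAZ, hBZ⟩ :=
    exists_partial_separator hG R w
  wlog hle : A.card ≤ B.card generalizing A B
  · obtain ⟨S', A', B', h1, h2, h3, h4, h5⟩ := this B A (by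
      intro x hx
      have := hcov hx
      simp only [Finset.mem_union] at this ⊢
      tauto) hB hA (by omega) hAB.symm hBZ hAZ (by omega)
    exact ⟨S', A', B', h1, h2, h3, h4, h5⟩
  refine ⟨S, A ∪ Z, B, ?_, hS, ?_, by nlinarith [pow_pos (two_pos : 0 < 2) w], ?_⟩
  · intro x hx
    have := hcov hx
    simp only [Finset.mem_union] at this ⊢
    tauto
  · have hc := Finset.card_union_le A Z
    have h1 : 2 ^ w * (2 * (A ∪ Z).card) ≤ 2 ^ w * (R.card + Z.card) :=
      Nat.mul_le_mul_left _ (by omega)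
    linarith
  · intro x hx y hy
    rcases Finset.mem_union.mp hx with hx | hx
    · exact hAB x hx y hy
    · exact hBZ.symm x hx y hy

end Separators

section JGraph

variable {a b m : ℕ}

theorem JGraph_adj_top (i : Fin a) (v : JVert a b (m + 1)) (h : Sum.inl i ≠ v) :
    (JGraph a b (m + 1)).Adj (Sum.inl i) v := by
  refine (SimpleGraph.fromRel_adj _ _ _).mpr ⟨h, Or.inl ?_⟩
  trivial

theorem JGraph_adj_left {x y : JVert a b m} (h : (JGraph a b m).Adj x y) :
    (JGraph a b (m + 1)).Adj (Sum.inr (Sum.inl x)) (Sum.inr (Sum.inl y)) := by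
  refine (SimpleGraph.fromRel_adj _ _ _).mpr ⟨?_, Or.inl h⟩
  exact fun e => h.ne (Sum.inl_injective (Sum.inr_injective e))

theorem JGraph_adj_right {x y : JVert a b m} (h : (JGraph a b m).Adj x y) :
    (JGraph a b (m + 1)).Adj (Sum.inr (Sum.inr x)) (Sum.inr (Sum.inr y)) := by
  refine (SimpleGraph.fromRel_adj _ _ _).mpr ⟨?_, Or.inl h⟩
  exact fun e => h.ne (Sum.inr_injective (Sum.inr_injective e))

instance JVert.finite (a b : ℕ) : (m : ℕ) → Finite (JVert a b m)
  | 0 => inferInstanceAs (Finite (Fin b))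
  | m + 1 =>
    have := JVert.finite a b m
    inferInstanceAs (Finite (Fin a ⊕ (JVert a b m ⊕ JVert a b m)))

theorem card_JVert_zero : Nat.card (JVert a b 0) = b := Nat.card_fin b

theorem card_JVert_succ :
    Nat.card (JVert a b (m + 1)) = a + 2 * Nat.card (JVert a b m) := by
  change Nat.card (Fin a ⊕ (JVert a b m ⊕ JVert a b m)) = _
  rw [Nat.card_sum, Nat.card_sum, Nat.card_fin]
  ring

theorem card_JVert_le : Nat.card (JVert a b m) + a = 2 ^ m * (a + b) := by
  induction m with
  | zero => rw [card_JVert_zero]; ring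
  | succ m ih => rw [card_JVert_succ, pow_succ, mul_right_comm, ← ih]; ring

theorem edgeSet_JGraph_succ_subset :
    (JGraph a b (m + 1)).edgeSet ⊆
      Set.range (fun q : Fin a × JVert a b (m + 1) =>
        (s((Sum.inl q.1 : JVert a b (m + 1)), q.2) : Sym2 (JVert a b (m + 1)))) ∪
      (Sym2.map (fun x => (Sum.inr (Sum.inl x) : JVert a b (m + 1))) '' (JGraph a b m).edgeSet ∪
      Sym2.map (fun x => (Sum.inr (Sum.inr x) : JVert a b (m + 1))) '' (JGraph a b m).edgeSet) := by
  intro e he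
  induction e using Sym2.ind with
  | _ u v =>
    obtain ⟨-, h⟩ := (SimpleGraph.fromRel_adj _ _ _).mp ((SimpleGraph.mem_edgeSet _).mp he)
    rcases u with i | x | x
    · exact Or.inl ⟨(i, v), rfl⟩
    · rcases v with i | y | y
      · exact Or.inl ⟨(i, Sum.inr (Sum.inl x)), Sym2.eq_swap⟩
      · exact Or.inr (Or.inl ⟨s(x, y), h.elim id fun h => h.symm, rfl⟩)
      · exact (h.elim id id).elim
    · rcases v with i | y | y
      · exact Or.inl ⟨(i, Sum.inr (Sum.inr x)), Sym2.eq_swap⟩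
      · exact (h.elim id id).elim
      · exact Or.inr (Or.inr ⟨s(x, y), h.elim id fun h => h.symm, rfl⟩)

theorem ncard_edgeSet_JGraph_le :
    (JGraph a b m).edgeSet.ncard ≤ Nat.card (JVert a b m) * (a * m + b) := by
  induction m with
  | zero =>
    have hsub : (JGraph a b 0).edgeSet ⊆
        Set.range (fun q : JVert a b 0 × JVert a b 0 => s(q.1, q.2)) := by
      intro e _
      induction e using Sym2.ind with
      | _ u v => exact ⟨(u, v), rfl⟩
    calc (JGraph a b 0).edgeSet.ncard ≤ _ := Set.ncard_le_ncard hsub (Set.toFinite _)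
      _ ≤ Nat.card (JVert a b 0 × JVert a b 0) := by
        rw [← Nat.card_coe_set_eq]; exact Finite.card_range_le _
      _ = _ := by rw [Nat.card_prod, card_JVert_zero]; ring
  | succ m ih =>
    have h1 := Set.ncard_le_ncard (edgeSet_JGraph_succ_subset (a := a) (b := b) (m := m))
      (Set.toFinite _)
    have h2 := h1.trans ((Set.ncard_union_le _ _).trans
      (Nat.add_le_add_left (Set.ncard_union_le _ _) _))
    have h3 : (Set.range (fun q : Fin a × JVert a b (m + 1) =>
        (s((Sum.inl q.1 : JVert a b (m + 1)), q.2) : Sym2 (JVert a b (m + 1))))).ncard ≤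
        a * Nat.card (JVert a b (m + 1)) := by
      rw [← Nat.card_coe_set_eq]
      refine (Finite.card_range_le _).trans ?_
      rw [Nat.card_prod, Nat.card_fin]
    have h4 := Set.ncard_image_le (f := Sym2.map fun x =>
      (Sum.inr (Sum.inl x) : JVert a b (m + 1))) (Set.toFinite (JGraph a b m).edgeSet)
    have h5 := Set.ncard_image_le (f := Sym2.map fun x =>
      (Sum.inr (Sum.inr x) : JVert a b (m + 1))) (Set.toFinite (JGraph a b m).edgeSet)
    have h6 : 2 * Nat.card (JVert a b m) ≤ Nat.card (JVert a b (m + 1)) := by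
      rw [card_JVert_succ]; omega
    have h7 := Nat.mul_le_mul_right (a * m + b) h6
    refine h2.trans ((Nat.add_le_add h3 (Nat.add_le_add h4 h5)).trans ?_)
    nlinarith

theorem exists_injOn_fin {V : Type*} (S : Finset V) {k : ℕ} (hk : 0 < k) (hS : S.card ≤ k) :
    ∃ g : V → Fin k, Set.InjOn g S := by
  have : Nonempty (Fin k) := ⟨⟨0, hk⟩⟩
  obtain ⟨g, -, hg⟩ := S.finite_toSet.exists_injOn_of_encard_le (t := (Set.univ : Set (Fin k)))
    (by simpa [Set.encard_univ] using hS)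
  exact ⟨g, hg⟩

/-- `JGraph w b m` contains every forest on at most `b * (2 / (1 + 2⁻ʷ)) ^ m` vertices. -/
theorem exists_embedding_JGraph {V : Type*} [DecidableEq V] {G : SimpleGraph V}
    (hG : G.IsAcyclic) {w b : ℕ} (hw : 0 < w) (hb : 0 < b) (m : ℕ) (R : Finset V)
    (hR : (2 ^ w + 1) ^ m * R.card ≤ (2 * 2 ^ w) ^ m * b) :
    ∃ f : V → JVert w b m, Set.InjOn f R ∧
      ∀ x ∈ R, ∀ y ∈ R, G.Adj x y → (JGraph w b m).Adj (f x) (f y) := by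
  induction m generalizing R with
  | zero =>
    obtain ⟨g, hg⟩ := exists_injOn_fin R hb (by simpa using hR)
    exact ⟨g, hg, fun x hx y hy hxy h => hxy.ne (hg hx hy h)⟩
  | succ m ih =>
    obtain ⟨S, A, B, hcov, hS, hA, hB, hAB⟩ := exists_balanced_separator hG R w
    have hpart : ∀ A : Finset V, 2 * 2 ^ w * A.card ≤ (2 ^ w + 1) * R.card →
        (2 ^ w + 1) ^ m * A.card ≤ (2 * 2 ^ w) ^ m * b := by
      intro A hA
      refine le_of_mul_le_mul_left (a := 2 * 2 ^ w) ?_ (by positivity)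
      calc 2 * 2 ^ w * ((2 ^ w + 1) ^ m * A.card)
          = (2 ^ w + 1) ^ m * (2 * 2 ^ w * A.card) := by ring
        _ ≤ (2 ^ w + 1) ^ m * ((2 ^ w + 1) * R.card) := Nat.mul_le_mul_left _ hA
        _ = (2 ^ w + 1) ^ (m + 1) * R.card := by ring
        _ ≤ (2 * 2 ^ w) ^ (m + 1) * b := hR
        _ = 2 * 2 ^ w * ((2 * 2 ^ w) ^ m * b) := by ring
    obtain ⟨g, hg⟩ := exists_injOn_fin S hw hS
    obtain ⟨fA, hfA, hfA'⟩ := ih A (hpart A hA)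
    obtain ⟨fB, hfB, hfB'⟩ := ih B (hpart B hB)
    let f : V → JVert w b (m + 1) := fun x =>
      if x ∈ S then Sum.inl (g x) else if x ∈ A then Sum.inr (Sum.inl (fA x))
      else Sum.inr (Sum.inr (fB x))
    have hcases : ∀ x ∈ R, (x ∈ S ∧ f x = Sum.inl (g x)) ∨
        (x ∈ A ∧ f x = Sum.inr (Sum.inl (fA x))) ∨
        (x ∈ B ∧ f x = Sum.inr (Sum.inr (fB x))) := by
      intro x hx
      have := hcov hx
      simp only [Finset.mem_union] at this
      by_cases h1 : x ∈ S
      · exact Or.inl ⟨h1, if_pos h1⟩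
      · by_cases h2 : x ∈ A
        · exact Or.inr (Or.inl ⟨h2, (if_neg h1).trans (if_pos h2)⟩)
        · exact Or.inr (Or.inr ⟨by tauto, (if_neg h1).trans (if_neg h2)⟩)
    have hinj : Set.InjOn f R := by
      intro x hx y hy hxy
      rcases hcases x hx with ⟨hx', ex⟩ | ⟨hx', ex⟩ | ⟨hx', ex⟩ <;>
      rcases hcases y hy with ⟨hy', ey⟩ | ⟨hy', ey⟩ | ⟨hy', ey⟩ <;>
      rw [ex, ey] at hxy
      · exact hg hx' hy' (Sum.inl_injective hxy)
      · exact (Sum.inl_ne_inr hxy).elim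
      · exact (Sum.inl_ne_inr hxy).elim
      · exact (Sum.inr_ne_inl hxy).elim
      · exact hfA hx' hy' (Sum.inl_injective (Sum.inr_injective hxy))
      · exact (Sum.inl_ne_inr (Sum.inr_injective hxy)).elim
      · exact (Sum.inr_ne_inl hxy).elim
      · exact (Sum.inr_ne_inl (Sum.inr_injective hxy)).elim
      · exact hfB hx' hy' (Sum.inr_injective (Sum.inr_injective hxy))
    refine ⟨f, hinj, fun x hx y hy hxy => ?_⟩
    have hne : f x ≠ f y := fun h => hxy.ne (hinj hx hy h)
    rcases hcases x hx with ⟨hx', ex⟩ | hx'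
    · rw [ex] at hne ⊢
      exact JGraph_adj_top _ _ hne
    rcases hcases y hy with ⟨hy', ey⟩ | hy'
    · rw [ey] at hne ⊢
      exact (JGraph_adj_top _ _ hne.symm).symm
    rcases hx' with ⟨hx', ex⟩ | ⟨hx', ex⟩ <;> rcases hy' with ⟨hy', ey⟩ | ⟨hy', ey⟩ <;>
    rw [ex, ey]
    · exact JGraph_adj_left (hfA' x hx' y hy' hxy)
    · exact (hAB x hx' y hy' hxy).elim
    · exact (hAB y hy' x hx' hxy.symm).elim
    · exact JGraph_adj_right (hfB' x hx' y hy' hxy)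

theorem JGraph_contains_of_isAcyclic {n : ℕ} {T : SimpleGraph (Fin n)} (hT : T.IsAcyclic)
    {w b m : ℕ} (hw : 0 < w) (hb : 0 < b) (h : (2 ^ w + 1) ^ m * n ≤ (2 * 2 ^ w) ^ m * b) :
    Contains (JGraph w b m) T := by
  obtain ⟨f, hf, hadj⟩ := exists_embedding_JGraph hT hw hb m Finset.univ (by simpa using h)
  exact ⟨⟨f, fun {x y} hxy => hadj x (by simp) y (by simp) hxy⟩,
    fun x y hxy => hf (by simp) (by simp) hxy⟩

end JGraph

theorem succ_pow_le_two_mul_pow {K m : ℕ} (h : 2 * m ≤ K) : (K + 1) ^ m ≤ 2 * K ^ m := by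
  have hK : (0 : ℝ) < K + 1 := by positivity
  have hB := one_add_mul_le_pow (a := -(1 / ((K : ℝ) + 1))) (by
    have : 1 / ((K : ℝ) + 1) ≤ 1 := by rw [div_le_one hK]; simp
    linarith) m
  have h1 : 1 + -(1 / ((K : ℝ) + 1)) = K / (K + 1) := by field_simp; ring
  rw [h1, div_pow, le_div_iff₀ (by positivity)] at hB
  have h2 : (m : ℝ) * (1 / (K + 1)) ≤ 1 / 2 := by
    rw [mul_one_div, div_le_iff₀ hK]
    have : (2 * m : ℝ) ≤ K := by exact_mod_cast h
    linarith
  have h3 : (0 : ℝ) < ((K : ℝ) + 1) ^ m := by positivity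
  have h4 : ((K : ℝ) + 1) ^ m ≤ 2 * (K : ℝ) ^ m := by nlinarith
  exact_mod_cast h4

theorem statement_8 : ∃ C : ℝ, 0 < C ∧ ∃ N : ℕ, ∀ n : ℕ, N ≤ n →
    ∃ (V : Type) (U : SimpleGraph V), Finite V ∧
      (Nat.card V : ℝ) ≤ 20 * n ∧
      (U.edgeSet.ncard : ℝ) ≤ 20 * n * Real.logb 2 n * Real.logb (3/2) (Real.logb 2 n)
          + C * n * Real.log n ∧
      ∀ T : SimpleGraph (Fin n), T.IsTree → Contains U T := by
  refine ⟨120, by norm_num, 16, fun n hn => ?_⟩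
  obtain ⟨l, hl⟩ : ∃ l, l = Nat.log 2 n := ⟨_, rfl⟩
  obtain ⟨k, hk⟩ : ∃ k, k = Nat.log 2 l := ⟨_, rfl⟩
  have hl4 : 4 ≤ l := by rw [hl]; exact Nat.le_log_of_pow_le (by norm_num) (by omega)
  have hln : 2 ^ l ≤ n := by rw [hl]; exact Nat.pow_log_le_self 2 (by omega)
  have hnl : n < 2 ^ (l + 1) := by rw [hl]; exact Nat.lt_pow_succ_log_self (by norm_num) n
  have hkl : 2 ^ k ≤ l := by rw [hk]; exact Nat.pow_log_le_self 2 (by omega)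
  have hlk : l < 2 ^ (k + 1) := by rw [hk]; exact Nat.lt_pow_succ_log_self (by norm_num) l
  have hk2 : k + 2 ≤ l := by
    rcases Nat.lt_or_ge k 3 with h | h
    · omega
    · obtain ⟨j, rfl⟩ := Nat.exists_eq_add_of_le h
      have := Nat.lt_two_pow_self (n := j)
      rw [pow_add] at hkl
      omega
  obtain ⟨m, hm⟩ : ∃ m, l = m + k := ⟨l - k, by omega⟩
  have hcard : Nat.card (JVert (k + 2) (4 * l) m) ≤ 10 * n := by
    have h1 := card_JVert_le (a := k + 2) (b := 4 * l) (m := m)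
    have h2 : 2 ^ m * (k + 2 + 4 * l) ≤ 2 ^ m * (10 * 2 ^ k) :=
      Nat.mul_le_mul_left _ (by rw [pow_succ] at hlk; omega)
    have h3 : 2 ^ m * (10 * 2 ^ k) = 10 * 2 ^ l := by rw [hm, pow_add]; ring
    omega
  refine ⟨JVert (k + 2) (4 * l) m, JGraph (k + 2) (4 * l) m, inferInstance, ?_, ?_, ?_⟩
  · have : (Nat.card (JVert (k + 2) (4 * l) m) : ℝ) ≤ 10 * n := by exact_mod_cast hcard
    have : (0 : ℝ) ≤ n := by positivity
    linarith
  · have hedge : (JGraph (k + 2) (4 * l) m).edgeSet.ncard ≤ 10 * n * (l * (k + 6)) := by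
      refine ncard_edgeSet_JGraph_le.trans (Nat.mul_le_mul hcard ?_)
      have : (k + 2) * m ≤ (k + 2) * l := Nat.mul_le_mul_left _ (by omega)
      nlinarith
    have hedge' : ((JGraph (k + 2) (4 * l) m).edgeSet.ncard : ℝ) ≤ 10 * n * (l * (k + 6)) := by
      exact_mod_cast hedge
    have hn0 : (0 : ℝ) < n := by exact_mod_cast (by omega : 0 < n)
    have hL : (l : ℝ) ≤ Real.logb 2 n := by
      rw [hl]; exact Real.natLog_le_logb n 2
    have hl1 : (4 : ℝ) ≤ l := by exact_mod_cast hl4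
    have hlog2 := Real.log_two_gt_d9
    have hlog32 : Real.log (3 / 2) ≤ Real.log 2 := Real.log_le_log (by norm_num) (by norm_num)
    have hlog32' : 0 < Real.log (3 / 2) := Real.log_pos (by norm_num)
    have hK : (k : ℝ) ≤ Real.logb (3 / 2) (Real.logb 2 n) := by
      calc (k : ℝ) ≤ Real.logb 2 l := by rw [hk]; exact Real.natLog_le_logb l 2
        _ ≤ Real.logb 2 (Real.logb 2 n) :=
          Real.logb_le_logb_of_le (by norm_num) (by linarith) hL
        _ ≤ _ := by
          unfold Real.logb
          exact div_le_div_of_nonneg_left (Real.log_nonneg (by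
            have : (l : ℝ) ≤ Real.log n / Real.log 2 := hL
            linarith)) hlog32' hlog32
    have hLn : Real.logb 2 n ≤ 2 * Real.log n := by
      have : 0 ≤ Real.log n := Real.log_natCast_nonneg n
      unfold Real.logb
      rw [div_le_iff₀ (by linarith)]
      nlinarith
    have hk0 : (0 : ℝ) ≤ k := by positivity
    have h1 : (l : ℝ) * (k + 6) ≤
        Real.logb 2 n * (Real.logb (3 / 2) (Real.logb 2 n) + 6) :=
      mul_le_mul hL (by linarith) (by linarith) (by linarith)
    have h2 : 0 ≤ Real.logb 2 n * Real.logb (3 / 2) (Real.logb 2 n) :=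
      mul_nonneg (by linarith) (by linarith)
    calc _ ≤ 10 * n * (l * (k + 6) : ℝ) := hedge'
      _ ≤ 10 * n * (Real.logb 2 n * (Real.logb (3 / 2) (Real.logb 2 n) + 6)) := by gcongr
      _ ≤ n * (20 * (Real.logb 2 n * Real.logb (3 / 2) (Real.logb 2 n)) +
          120 * Real.log n) := by
        rw [mul_comm (10 : ℝ), mul_assoc]
        exact mul_le_mul_of_nonneg_left (by linarith) hn0.le
      _ = _ := by ring
  · intro T hT
    refine JGraph_contains_of_isAcyclic hT.isAcyclic (by omega) (by omega) ?_
    have h1 : (2 ^ (k + 2) + 1) ^ m ≤ 2 * (2 ^ (k + 2)) ^ m :=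
      succ_pow_le_two_mul_pow (by rw [pow_succ] at hlk ⊢; omega)
    have h2 : n ≤ 2 ^ m * (2 * l) := by
      have : 2 ^ (l + 1) = 2 ^ m * (2 * 2 ^ k) := by rw [hm, pow_succ, pow_add]; ring
      have h3 : 2 ^ m * (2 * 2 ^ k) ≤ 2 ^ m * (2 * l) := Nat.mul_le_mul_left _ (by omega)
      omega
    calc (2 ^ (k + 2) + 1) ^ m * n ≤ 2 * (2 ^ (k + 2)) ^ m * (2 ^ m * (2 * l)) :=
          Nat.mul_le_mul h1 h2
      _ = _ := by rw [mul_pow]; ring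
end

section
/- For every integer k ≥ 1 there exist constants C > 0 and N such that for every integer n ≥ N, s_k(n) ≤ C·k·n·(ln n)·(ln ln n); that is, there is a graph with at most C·k·n·(ln n)·(ln ln n) edges that contains every graph with n vertices and treewidth at most k. -/
open SimpleGraph

namespace SimpleGraph

variable {ι : Type*} {T : SimpleGraph ι}

/-- In a tree, the neighbour of `y` closer to `z` is unique. -/
lemma IsTree.eq_of_adj_of_dist_lt (hT : T.IsTree) {x x' y z : ι} (hx : T.Adj y x)
    (hx' : T.Adj y x') (h : T.dist x z < T.dist y z) (h' : T.dist x' z < T.dist y z) :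
    x = x' := by
  have key : ∀ x, T.Adj y x → T.dist x z < T.dist y z →
      ∃ p : T.Path y z, p.1.snd = x := by
    intro x hx h
    obtain ⟨p, hp⟩ := hT.connected.exists_walk_length_eq_dist x z
    have h1 : T.dist y x = 1 := dist_eq_one_iff_adj.2 hx
    have h2 := hT.connected.dist_triangle (u := y) (v := x) (w := z)
    refine ⟨⟨Walk.cons hx p, (Walk.cons hx p).isPath_of_length_eq_dist ?_⟩, by simp⟩
    rw [Walk.length_cons]
    omega
  obtain ⟨p, hp⟩ := key x hx h
  obtain ⟨p', hp'⟩ := key x' hx' h'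
  rw [← hp, ← hp', (hT.isAcyclic.subsingleton_path y z).elim p p']

lemma Connected.exists_adj_dist_lt (hT : T.Connected) {y z : ι} (h : z ≠ y) :
    ∃ x, T.Adj y x ∧ T.dist x z < T.dist y z := by
  obtain ⟨p, hp⟩ := hT.exists_walk_length_eq_dist y z
  cases p with
  | nil => exact absurd rfl h
  | cons hx q =>
    refine ⟨_, hx, ?_⟩
    have := dist_le q
    rw [Walk.length_cons] at hp
    omega

/-- The only edge of a tree leaving the branch at `y` away from `x` ends in `x`. -/
lemma IsTree.eq_of_adj_of_crossing (hT : T.IsTree) {x y z z' : ι} (hxy : T.Adj x y)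
    (hz : T.dist y z < T.dist x z) (hzz : T.Adj z z') (hz' : ¬ T.dist y z' < T.dist x z') :
    z' = x := by
  have t := fun a b c => hT.connected.dist_triangle (u := a) (v := b) (w := c)
  have hne := hT.dist_ne_of_adj z' hxy
  rw [dist_comm (u := z') (v := x), dist_comm (u := z') (v := y)] at hne
  have h1 : T.dist x y = 1 := dist_eq_one_iff_adj.2 hxy
  have h2 : T.dist z z' = 1 := dist_eq_one_iff_adj.2 hzz
  have c1 : T.dist y x = 1 := by rw [dist_comm, h1]
  have c2 : T.dist z' z = 1 := by rw [dist_comm, h2]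
  have a1 := t x y z
  have a2 := t y x z'
  have a3 := t y z z'
  have a4 := t x z' z
  by_cases hyz : y = z
  · subst hyz
    rw [dist_self] at *
    exact (hT.connected.dist_eq_zero_iff.1 (by omega : T.dist x z' = 0)).symm
  · exfalso
    obtain ⟨c, hc, hcd⟩ := hT.connected.exists_adj_dist_lt hyz
    have a5 := t c y x
    have e : c = z' := by
      refine hT.eq_of_adj_of_dist_lt (z := x) hc hzz ?_ ?_
      · rw [dist_comm (u := z) (v := y)] at hcd
        rw [dist_comm (u := z) (v := x)]
        omega
      · rw [dist_comm (u := z) (v := x), dist_comm (u := z') (v := x)]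
        omega
    rw [e, dist_comm (u := z') (v := y), dist_comm (u := z) (v := y)] at hcd
    omega

/-- A connected set of nodes avoiding `x` and meeting a branch at `x` lies in that branch. -/
lemma IsTree.dist_lt_of_induce_connected (hT : T.IsTree) {x y : ι} (hxy : T.Adj x y) {P : Set ι}
    (hP : (T.induce P).Connected) (hx : x ∉ P) {z z' : ι} (hz : z ∈ P) (hz' : z' ∈ P)
    (h : T.dist y z < T.dist x z) : T.dist y z' < T.dist x z' := by
  have hr := (reachable_iff_reflTransGen _ _).1 (hP.preconnected ⟨z, hz⟩ ⟨z', hz'⟩)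
  have key : ∀ q : P, Relation.ReflTransGen (T.induce P).Adj ⟨z, hz⟩ q →
      T.dist y q < T.dist x q := by
    intro q hq
    induction hq with
    | refl => exact h
    | @tail b c _ hbc ih =>
      by_contra hc
      exact hx (hT.eq_of_adj_of_crossing hxy ih hbc hc ▸ c.2)
  exact key _ hr

end SimpleGraph

section Separation

variable {V : Type*}

namespace TreeDecomp

variable {ι : Type*} {G : SimpleGraph V} {T : SimpleGraph ι} (td : TreeDecomp G T)

open Classical in
/-- The vertices of `X` all of whose bags lie in the branch of `y` away from each node of `Q`. -/
noncomputable def branch (X : Finset V) (y : ι) (Q : Set ι) : Finset V :=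
  {v ∈ X | ∀ z, v ∈ td.bag z → ∀ q ∈ Q, T.dist y z < T.dist q z}

open Classical in
/-- The part of `X` in the bag of `y`. -/
noncomputable def bagIn (X : Finset V) (y : ι) : Finset V := {v ∈ X | v ∈ td.bag y}

variable {td} in
lemma mem_branch {X : Finset V} {y : ι} {Q : Set ι} {v : V} : v ∈ td.branch X y Q ↔
    v ∈ X ∧ ∀ z, v ∈ td.bag z → ∀ q ∈ Q, T.dist y z < T.dist q z := by
  classical exact Finset.mem_filter

variable {td} in
lemma mem_bagIn {X : Finset V} {y : ι} {v : V} : v ∈ td.bagIn X y ↔ v ∈ X ∧ v ∈ td.bag y := by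
  classical exact Finset.mem_filter

lemma bagIn_subset (X : Finset V) (y : ι) : td.bagIn X y ⊆ X := fun _ hv => (mem_bagIn.1 hv).1

lemma card_bagIn_le [Finite V] (X : Finset V) (y : ι) : (td.bagIn X y).card ≤ (td.bag y).ncard := by
  rw [← Set.ncard_coe_finset]
  exact Set.ncard_le_ncard (fun v hv => (mem_bagIn.1 (Finset.mem_coe.1 hv)).2)

lemma exists_mem_bag (v : V) : ∃ z, v ∈ td.bag z := by
  obtain ⟨z, hz⟩ := (td.bag_connected v).nonempty
  exact ⟨z, hz⟩

lemma mem_branch_of_mem_bag {X : Finset V} {y y' z : ι} {v : V} (hyy : T.Adj y y') (hvX : v ∈ X)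
    (hy : v ∉ td.bag y) (hz : v ∈ td.bag z) (h : T.dist y' z < T.dist y z) :
    v ∈ td.branch X y' {y} := by
  refine mem_branch.2 ⟨hvX, fun z' hz' q hq => ?_⟩
  rw [Set.mem_singleton_iff.1 hq]
  exact td.isTree.dist_lt_of_induce_connected hyy (td.bag_connected v) hy hz hz' h

lemma not_mem_bag_of_mem_branch {X : Finset V} {y y' : ι} {v : V}
    (h : v ∈ td.branch X y' {y}) : v ∉ td.bag y := by
  intro hv
  have := (mem_branch.1 h).2 y hv y rfl
  simp at this

lemma branch_subset_branch (X : Finset V) {y y' : ι} {Q : Set ι} (hQ : ∀ q ∈ Q, T.Adj y q)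
    (hyy : T.Adj y y') (hy' : y' ∉ Q) : td.branch X y' {y} ⊆ td.branch X y Q := by
  intro v hv
  obtain ⟨hvX, hv⟩ := mem_branch.1 hv
  refine mem_branch.2 ⟨hvX, fun z hz q hq => ?_⟩
  by_contra hlt
  have hne := td.isTree.dist_ne_of_adj z (hQ q hq)
  rw [SimpleGraph.dist_comm (u := z) (v := y), SimpleGraph.dist_comm (u := z) (v := q)] at hne
  exact hy' (td.isTree.eq_of_adj_of_dist_lt (hQ q hq) hyy (by omega) (hv z hz y rfl) ▸ hq)

/-- There is a node one of whose branches has total weight at least `t`, while the weight of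
each smaller branch is at most `t`. -/
lemma exists_light_branches (X : Finset V) (t : ℕ) (ht : t ≤ X.card) :
    ∃ (y : ι) (Q : Set ι), (∀ q ∈ Q, T.Adj y q) ∧ t ≤ (td.branch X y Q).card ∧
      ∀ y', T.Adj y y' → y' ∉ Q → (td.branch X y' {y}).card ≤ t := by
  choose r hr using td.exists_mem_bag
  have key : ∀ (N : ℕ) (y : ι) (Q : Set ι), (∀ q ∈ Q, T.Adj y q) →
      t ≤ (td.branch X y Q).card → ∑ v ∈ td.branch X y Q, (T.dist y (r v) + 1) ≤ N →
      ∃ (y : ι) (Q : Set ι), (∀ q ∈ Q, T.Adj y q) ∧ t ≤ (td.branch X y Q).card ∧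
        ∀ y', T.Adj y y' → y' ∉ Q → (td.branch X y' {y}).card ≤ t := by
    intro N
    induction N with
    | zero =>
      intro y Q hQ hty hN
      refine ⟨y, Q, hQ, hty, fun y' hyy hy' => ?_⟩
      have h0 : td.branch X y Q = ∅ := by
        by_contra hne
        obtain ⟨v, hv⟩ := Finset.nonempty_iff_ne_empty.2 hne
        have := Finset.single_le_sum (f := fun v => T.dist y (r v) + 1)
          (fun _ _ => Nat.zero_le _) hv
        omega
      have := Finset.card_le_card (td.branch_subset_branch X hQ hyy hy')
      rw [h0, Finset.card_empty] at this
      omega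
    | succ N ih =>
      intro y Q hQ hty hN
      by_cases hall : ∀ y', T.Adj y y' → y' ∉ Q → (td.branch X y' {y}).card ≤ t
      · exact ⟨y, Q, hQ, hty, hall⟩
      · push Not at hall
        obtain ⟨y', hyy, hy', hlt⟩ := hall
        refine ih y' {y} (fun q hq => hq ▸ hyy.symm) hlt.le ?_
        have hsub := td.branch_subset_branch X hQ hyy hy'
        have h1 : ∑ v ∈ td.branch X y' {y}, (T.dist y' (r v) + 1) <
            ∑ v ∈ td.branch X y' {y}, (T.dist y (r v) + 1) := by
          refine Finset.sum_lt_sum_of_nonempty (Finset.card_pos.1 (by omega)) fun v hv => ?_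
          have := (mem_branch.1 hv).2 (r v) (hr v) y rfl
          omega
        have h2 : ∑ v ∈ td.branch X y' {y}, (T.dist y (r v) + 1) ≤
            ∑ v ∈ td.branch X y Q, (T.dist y (r v) + 1) :=
          Finset.sum_le_sum_of_subset hsub
        omega
  obtain ⟨x⟩ := td.isTree.connected.nonempty
  refine key _ x ∅ (by simp) ?_ le_rfl
  have : td.branch X x ∅ = X := by ext; simp [mem_branch]
  rwa [this]

end TreeDecomp

variable [DecidableEq V]

/-- `S` separates `A` from the rest of `X` in `G`. -/
structure Separates (G : SimpleGraph V) (X S A : Finset V) : Prop where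
  sep_subset : S ⊆ X
  subset : A ⊆ X \ S
  not_adj : ∀ u ∈ A, ∀ v ∈ X, v ∉ A → v ∉ S → ¬ G.Adj u v

lemma Separates.union {G : SimpleGraph V} {X S A B : Finset V} (hA : Separates G X S A)
    (hB : Separates G X S B) : Separates G X S (A ∪ B) where
  sep_subset := hA.sep_subset
  subset := Finset.union_subset hA.subset hB.subset
  not_adj u hu v hv hvA hvS := by
    rw [Finset.mem_union, not_or] at hvA
    rcases Finset.mem_union.1 hu with h | h
    · exact hA.not_adj u h v hv hvA.1 hvS
    · exact hB.not_adj u h v hv hvA.2 hvS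

/-- Separations can be refined inside what is left. -/
lemma Separates.trans {G : SimpleGraph V} {X S A S' A' : Finset V} (h : Separates G X S A)
    (h' : Separates G (X \ (S ∪ A)) S' A') : Separates G X (S ∪ S') (A ∪ A') where
  sep_subset := Finset.union_subset h.sep_subset (h'.sep_subset.trans Finset.sdiff_subset)
  subset := by
    have h1 := h.subset
    have h2 := h'.subset
    have h3 := h'.sep_subset
    intro v hv
    have a1 := @h1 v
    have a2 := @h2 v
    have a3 := @h3 v
    simp only [Finset.mem_union, Finset.mem_sdiff] at *
    tauto
  not_adj u hu v hv hvA hvS := by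
    rw [Finset.mem_union, not_or] at hvA hvS
    rcases Finset.mem_union.1 hu with hu | hu
    · exact h.not_adj u hu v hv hvA.1 hvS.1
    · refine h'.not_adj u hu v ?_ hvA.2 hvS.2
      simp [hv, hvA.1, hvS.1]

namespace TreeDecomp

variable {ι : Type*} {G : SimpleGraph V} {T : SimpleGraph ι} (td : TreeDecomp G T)

lemma separates_branch (X : Finset V) {y y' : ι} (hyy : T.Adj y y') :
    Separates G X (td.bagIn X y) (td.branch X y' {y}) where
  sep_subset := td.bagIn_subset X y
  subset v hv := by
    refine Finset.mem_sdiff.2 ⟨(mem_branch.1 hv).1, fun h => ?_⟩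
    exact td.not_mem_bag_of_mem_branch hv (mem_bagIn.1 h).2
  not_adj u hu v hv hvA hvS huv := by
    obtain ⟨z, huz, hvz⟩ := td.bag_edge huv
    refine hvA (td.mem_branch_of_mem_bag hyy hv (fun h => hvS (mem_bagIn.2 ⟨hv, h⟩)) hvz ?_)
    exact (mem_branch.1 hu).2 z huz y rfl

/-- A single bag separates a set whose size is within a factor two below the target `t`,
unless it overshoots the target together with the bag itself. -/
lemma exists_separates [Fintype V] (X : Finset V) (t : ℕ) (ht : t ≤ X.card) :
    ∃ (y : ι) (A : Finset V), Separates G X (td.bagIn X y) A ∧ A.card ≤ t ∧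
      (t ≤ 2 * A.card ∨ t ≤ A.card + (td.bagIn X y).card) := by
  classical
  obtain ⟨y, Q, hQ, hty, hlight⟩ := td.exists_light_branches X t ht
  let C : Finset (Finset V) := {A | Separates G X (td.bagIn X y) A ∧ A.card ≤ t}
  have hC : C.Nonempty := ⟨∅, Finset.mem_filter.2 ⟨Finset.mem_univ _,
    ⟨td.bagIn_subset X y, Finset.empty_subset _, by simp⟩, by simp⟩⟩
  obtain ⟨A, hA, hmax⟩ := Finset.exists_max_image C Finset.card hC
  obtain ⟨-, hsep, hAt⟩ := Finset.mem_filter.1 hA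
  refine ⟨y, A, hsep, hAt, or_iff_not_imp_left.2 fun hsmall => ?_⟩
  have hsub : ∀ y', T.Adj y y' → y' ∉ Q → td.branch X y' {y} ⊆ A := by
    intro y' hyy hy'
    have hs := td.separates_branch X hyy
    have h1 := hmax _ (Finset.mem_filter.2 ⟨Finset.mem_univ _, hs, hlight y' hyy hy'⟩)
    have h2 := Finset.card_union_le A (td.branch X y' {y})
    have h3 := hmax _ (Finset.mem_filter.2 ⟨Finset.mem_univ _, hsep.union hs, by omega⟩)
    have h4 := Finset.eq_of_subset_of_card_le Finset.subset_union_left h3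
    rw [h4]
    exact Finset.subset_union_right
  have hcov : td.branch X y Q ⊆ A ∪ td.bagIn X y := by
    intro v hv
    obtain ⟨hvX, hv⟩ := mem_branch.1 hv
    by_cases hy : v ∈ td.bag y
    · exact Finset.mem_union_right _ (mem_bagIn.2 ⟨hvX, hy⟩)
    · obtain ⟨z, hz⟩ := td.exists_mem_bag v
      obtain ⟨y', hyy, hd⟩ := td.isTree.connected.exists_adj_dist_lt
        (show z ≠ y from fun h => hy (h ▸ hz))
      refine Finset.mem_union_left _ (hsub y' hyy (fun hq => ?_)
        (td.mem_branch_of_mem_bag hyy hvX hy hz hd))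
      exact absurd hd (hv z hz y' hq).not_gt
  exact hty.trans ((Finset.card_le_card hcov).trans (Finset.card_union_le _ _))

end TreeDecomp

/-- With `w` bags the target can be approximated up to a relative error `2 ^ (-w)`. -/
lemma HasTreewidthLE.exists_separates [Fintype V] {G : SimpleGraph V} {k : ℕ}
    (hG : HasTreewidthLE G k) (w : ℕ) (X : Finset V) (t : ℕ) (ht : t ≤ X.card) :
    ∃ S A : Finset V, Separates G X S A ∧ S.card ≤ (k + 1) * w ∧ A.card ≤ t ∧
      2 ^ w * t ≤ 2 ^ w * (A.card + S.card) + t := by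
  obtain ⟨ι, T, td, hk⟩ := hG
  induction w generalizing X t with
  | zero => exact ⟨∅, ∅, ⟨by simp, by simp, by simp⟩, by simp, by simp, by simp⟩
  | succ w ih =>
    obtain ⟨y, A, hsep, hA, hor⟩ := td.exists_separates X t ht
    set S := td.bagIn X y with hS
    have hSk : S.card ≤ k + 1 := (td.card_bagIn_le X y).trans (hk y)
    have hdisj : Disjoint S A :=
      Finset.disjoint_left.2 fun v hv hv' => (Finset.mem_sdiff.1 (hsep.subset hv')).2 hv
    have hSA : S ∪ A ⊆ X :=
      Finset.union_subset hsep.sep_subset (hsep.subset.trans Finset.sdiff_subset)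
    have hc := Finset.card_sdiff_add_card_eq_card hSA
    rw [Finset.card_union_of_disjoint hdisj] at hc
    obtain ⟨S', A', hsep', hS', hA', hd⟩ := ih (X \ (S ∪ A)) (t - A.card - S.card) (by omega)
    have hdS : (S ∪ S').card = S.card + S'.card := Finset.card_union_of_disjoint <|
      Finset.disjoint_left.2 fun v hv hv' => by
        have := hsep'.sep_subset hv'
        simp [hv] at this
    have hdA : (A ∪ A').card = A.card + A'.card := Finset.card_union_of_disjoint <|
      Finset.disjoint_left.2 fun v hv hv' => by
        have := hsep'.subset hv'
        simp [hv] at this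
    refine ⟨_, _, hsep.trans hsep', ?_, ?_, ?_⟩
    · rw [hdS, mul_add]
      omega
    · rw [hdA]
      omega
    · rw [hdS, hdA]
      set t' := t - A.card - S.card with ht'
      have h1 : t ≤ t' + A.card + S.card := by omega
      have h2 : 2 * t' ≤ t := by omega
      rw [pow_succ]
      nlinarith [Nat.mul_le_mul_left (2 ^ w) h1]

end Separation

section Embedding

instance JVert.instFinite (a b m : ℕ) : Finite (JVert a b m) := by
  induction m with
  | zero => exact inferInstanceAs (Finite (Fin b))
  | succ m ih => exact inferInstanceAs (Finite (Fin a ⊕ (JVert a b m ⊕ JVert a b m)))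

lemma JVert.nonempty (a : ℕ) {b : ℕ} (hb : 0 < b) (m : ℕ) : Nonempty (JVert a b m) := by
  induction m with
  | zero => exact ⟨(⟨0, hb⟩ : Fin b)⟩
  | succ m ih => exact ih.elim fun x => ⟨Sum.inr (Sum.inl x)⟩

lemma Finset.exists_injOn_fin {V : Type*} (X : Finset V) {b : ℕ} (hb : 0 < b) (h : X.card ≤ b) :
    ∃ f : V → Fin b, Set.InjOn f X := by
  have : Nonempty (Fin b) := ⟨⟨0, hb⟩⟩
  obtain ⟨f, -, hf⟩ := X.finite_toSet.exists_injOn_of_encard_le (t := (Set.univ : Set (Fin b)))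
    (by simpa [Set.encard_univ] using h)
  exact ⟨f, hf⟩

variable {V : Type*} [Fintype V] [DecidableEq V]

/-- Recursive separation embeds a graph of treewidth at most `k` into the separator graph. -/
lemma HasTreewidthLE.exists_embedding {G : SimpleGraph V} {k w b : ℕ} (hG : HasTreewidthLE G k)
    (hw : 0 < w) (hbw : b ≤ 2 ^ w) (hb : 0 < b) (m : ℕ) (hm : m ≤ b) (X : Finset V)
    (hX : X.card ≤ 2 ^ m * (b - m)) :
    ∃ f : V → JVert ((k + 1) * w) b m, Set.InjOn f X ∧
      ∀ u ∈ X, ∀ v ∈ X, G.Adj u v → (JGraph ((k + 1) * w) b m).Adj (f u) (f v) := by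
  induction m generalizing X with
  | zero =>
    obtain ⟨f, hf⟩ := X.exists_injOn_fin hb (by simpa using hX)
    exact ⟨f, hf, fun u hu v hv huv => fun h => huv.ne (hf hu hv h)⟩
  | succ m ih =>
    set t := (X.card + 1) / 2 with ht
    obtain ⟨S, A, hsep, hS, hA, hd⟩ := hG.exists_separates w X t (by omega)
    set B := X \ (S ∪ A) with hB
    have hdisj : Disjoint S A :=
      Finset.disjoint_left.2 fun v hv hv' => (Finset.mem_sdiff.1 (hsep.subset hv')).2 hv
    have hSA : S ∪ A ⊆ X :=
      Finset.union_subset hsep.sep_subset (hsep.subset.trans Finset.sdiff_subset)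
    have hc := Finset.card_sdiff_add_card_eq_card hSA
    rw [Finset.card_union_of_disjoint hdisj, ← hB] at hc
    obtain ⟨r, rfl⟩ : ∃ r, b = m + 1 + r := ⟨b - (m + 1), by omega⟩
    have e1 : m + 1 + r - (m + 1) = r := by omega
    have e2 : m + 1 + r - m = r + 1 := by omega
    rw [e1, pow_succ] at hX
    rw [e2] at ih
    have htr : t ≤ 2 ^ m * r := by
      have : 2 ^ m * 2 * r = 2 * (2 ^ m * r) := by ring
      omega
    have htw : t ≤ 2 ^ w * 2 ^ m := by
      calc t ≤ 2 ^ m * r := htr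
        _ ≤ 2 ^ m * 2 ^ w := Nat.mul_le_mul_left _ (by omega)
        _ = _ := mul_comm _ _
    have hAc : A.card ≤ 2 ^ m * (r + 1) := by
      rw [mul_add]
      omega
    have hBc : B.card ≤ 2 ^ m * (r + 1) := by
      have h1 : B.card + (A.card + S.card) ≤ 2 * t := by omega
      have h2 : 2 ^ w * B.card ≤ 2 ^ w * (t + 2 ^ m) := by
        have := Nat.mul_le_mul_left (2 ^ w) h1
        nlinarith
      have h3 := Nat.le_of_mul_le_mul_left h2 (by positivity)
      rw [mul_add]
      omega
    obtain ⟨fA, hfA, hfA'⟩ := ih (by omega) A hAc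
    obtain ⟨fB, hfB, hfB'⟩ := ih (by omega) B hBc
    obtain ⟨g, hg⟩ := S.exists_injOn_fin (by positivity) hS
    let f : V → JVert ((k + 1) * w) (m + 1 + r) (m + 1) := fun v =>
      if v ∈ S then Sum.inl (g v) else if v ∈ A then Sum.inr (Sum.inl (fA v))
      else Sum.inr (Sum.inr (fB v))
    have fS : ∀ v ∈ S, f v = Sum.inl (g v) := fun v hv => if_pos hv
    have fAe : ∀ v ∉ S, v ∈ A → f v = Sum.inr (Sum.inl (fA v)) := fun v hv hv' =>
      (if_neg hv).trans (if_pos hv')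
    have fBe : ∀ v ∉ S, v ∉ A → f v = Sum.inr (Sum.inr (fB v)) := fun v hv hv' =>
      (if_neg hv).trans (if_neg hv')
    have memB : ∀ v ∈ X, v ∉ S → v ∉ A → v ∈ B := fun v hv h1 h2 => by simp [hB, hv, h1, h2]
    have hinj : Set.InjOn f X := by
      intro u hu v hv huv
      by_cases uS : u ∈ S <;> by_cases vS : v ∈ S
      · rw [fS u uS, fS v vS] at huv
        exact hg uS vS (Sum.inl.inj huv)
      · by_cases vA : v ∈ A
        · rw [fS u uS, fAe v vS vA] at huv
          cases huv
        · rw [fS u uS, fBe v vS vA] at huv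
          cases huv
      · by_cases uA : u ∈ A
        · rw [fS v vS, fAe u uS uA] at huv
          cases huv
        · rw [fS v vS, fBe u uS uA] at huv
          cases huv
      · by_cases uA : u ∈ A <;> by_cases vA : v ∈ A
        · rw [fAe u uS uA, fAe v vS vA] at huv
          exact hfA uA vA (Sum.inl.inj (Sum.inr.inj huv))
        · rw [fAe u uS uA, fBe v vS vA] at huv
          cases huv
        · rw [fBe u uS uA, fAe v vS vA] at huv
          cases huv
        · rw [fBe u uS uA, fBe v vS vA] at huv
          exact hfB (memB u hu uS uA) (memB v hv vS vA) (Sum.inr.inj (Sum.inr.inj huv))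
    refine ⟨f, hinj, fun u hu v hv huv => ?_⟩
    have hne : f u ≠ f v := fun h => huv.ne (hinj hu hv h)
    refine (SimpleGraph.fromRel_adj _ _ _).2 ⟨hne, ?_⟩
    by_cases uS : u ∈ S
    · rw [fS u uS]
      exact Or.inl trivial
    by_cases vS : v ∈ S
    · rw [fS v vS]
      exact Or.inr trivial
    refine Or.inl ?_
    by_cases uA : u ∈ A <;> by_cases vA : v ∈ A
    · rw [fAe u uS uA, fAe v vS vA]
      exact hfA' u uA v vA huv
    · exact absurd huv (hsep.not_adj u uA v hv vA vS)
    · exact absurd huv.symm (hsep.not_adj v vA u hu uA uS)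
    · rw [fBe u uS uA, fBe v vS vA]
      exact hfB' u (memB u hu uS uA) v (memB v hv vS vA) huv

end Embedding

section Counting

lemma JVert.card_add (a b m : ℕ) : Nat.card (JVert a b m) + a = 2 ^ m * (a + b) := by
  induction m with
  | zero =>
    have : Nat.card (JVert a b 0) = b := Nat.card_fin b
    rw [this, pow_zero, one_mul, add_comm]
  | succ m ih =>
    have : Nat.card (JVert a b (m + 1)) =
        a + (Nat.card (JVert a b m) + Nat.card (JVert a b m)) := by
      change Nat.card (Fin a ⊕ (JVert a b m ⊕ JVert a b m)) = _
      rw [Nat.card_sum, Nat.card_sum, Nat.card_fin]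
    rw [this, pow_succ]
    linarith

lemma JGraph.edgeSet_succ_subset (a b m : ℕ) : (JGraph a b (m + 1)).edgeSet ⊆
    (fun p : Fin a × JVert a b (m + 1) => (s(Sum.inl p.1, p.2) : Sym2 (JVert a b (m + 1)))) ''
      Set.univ ∪
    ((Sym2.map fun x => (Sum.inr (Sum.inl x) : JVert a b (m + 1))) '' (JGraph a b m).edgeSet ∪
    (Sym2.map fun x => (Sum.inr (Sum.inr x) : JVert a b (m + 1))) '' (JGraph a b m).edgeSet) := by
  intro e
  induction e with | _ u v
  intro he
  obtain ⟨hne, h⟩ := (SimpleGraph.fromRel_adj _ _ _).1 ((SimpleGraph.mem_edgeSet _).1 he)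
  rcases u with i | x | x
  · exact Or.inl ⟨(i, v), trivial, rfl⟩
  all_goals
    rcases v with j | y | y
    · exact Or.inl ⟨(j, _), trivial, Sym2.eq_swap⟩
    all_goals first
      | exact h.elim False.elim False.elim
      | exact Or.inr (Or.inl ⟨s(x, y), h.elim id fun h' => h'.symm, rfl⟩)
      | exact Or.inr (Or.inr ⟨s(x, y), h.elim id fun h' => h'.symm, rfl⟩)

lemma JGraph.ncard_edgeSet_le (a b m : ℕ) :
    (JGraph a b m).edgeSet.ncard ≤ 2 ^ m * (b ^ 2 + m * (a * (a + b))) := by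
  induction m with
  | zero =>
    have h1 : (JGraph a b 0).edgeSet ⊆
        (fun p : Fin b × Fin b => (s(p.1, p.2) : Sym2 (JVert a b 0))) '' Set.univ := by
      intro e
      induction e with | _ u v
      exact fun _ => ⟨(u, v), trivial, rfl⟩
    have h2 := (Set.ncard_le_ncard h1 (Set.toFinite _)).trans (Set.ncard_image_le (Set.toFinite _))
    rw [Set.ncard_univ, Nat.card_prod, Nat.card_fin] at h2
    simpa [sq] using h2
  | succ m ih =>
    have h1 := Set.ncard_le_ncard (edgeSet_succ_subset a b m) (Set.toFinite _)
    have h2 := Set.ncard_image_le (f := fun p : Fin a × JVert a b (m + 1) =>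
      (s(Sum.inl p.1, p.2) : Sym2 (JVert a b (m + 1)))) (Set.toFinite Set.univ)
    rw [Set.ncard_univ, Nat.card_prod, Nat.card_fin] at h2
    have h3 := Set.ncard_image_le (f := Sym2.map fun x =>
      (Sum.inr (Sum.inl x) : JVert a b (m + 1))) (Set.toFinite (JGraph a b m).edgeSet)
    have h4 := Set.ncard_image_le (f := Sym2.map fun x =>
      (Sum.inr (Sum.inr x) : JVert a b (m + 1))) (Set.toFinite (JGraph a b m).edgeSet)
    have h5 := (Set.ncard_union_le _ _).trans (Nat.add_le_add h2
      ((Set.ncard_union_le _ _).trans (Nat.add_le_add h3 h4)))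
    have h6 := JVert.card_add a b (m + 1)
    have h7 : a * Nat.card (JVert a b (m + 1)) ≤ a * (2 ^ (m + 1) * (a + b)) :=
      Nat.mul_le_mul_left _ (by omega)
    have h8 : 2 ^ (m + 1) * (b ^ 2 + (m + 1) * (a * (a + b))) =
        a * (2 ^ (m + 1) * (a + b)) + 2 * (2 ^ m * (b ^ 2 + m * (a * (a + b)))) := by ring
    rw [h8, two_mul]
    exact (h1.trans h5).trans (Nat.add_le_add h7 (Nat.add_le_add ih ih))

end Counting

section Asymptotics

/-- The depth `m` of the universal graph on `n` vertices. -/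
lemma exists_depth {n : ℕ} (hn : 3 ≤ n) :
    ∃ m, 2 ≤ m ∧ n ≤ 2 ^ m * m ∧ 2 ^ m * m ≤ 4 * n ∧ 2 ^ (m - 1) ≤ n := by
  classical
  have hex : ∃ m, n ≤ 2 ^ m * m := ⟨n, Nat.le_mul_of_pos_left n (by positivity)⟩
  obtain ⟨j, hj⟩ : ∃ j, Nat.find hex = j := ⟨_, rfl⟩
  have h1 := Nat.find_spec hex
  have hmin : ∀ i < j, ¬ n ≤ 2 ^ i * i := fun i hi => Nat.find_min hex (hj ▸ hi)
  rw [hj] at h1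
  rcases j with _ | _ | i
  · simp at h1
    omega
  · simp at h1
    omega
  · have h2 := hmin (i + 1) (by omega)
    refine ⟨i + 2, by omega, h1, ?_, ?_⟩
    · rw [pow_succ]
      nlinarith [Nat.zero_le (2 ^ (i + 1) * i)]
    · rw [show i + 2 - 1 = i + 1 by omega]
      nlinarith [Nat.zero_le (2 ^ (i + 1) * i)]

lemma depth_le_log {n m : ℕ} (hm : 2 ≤ m) (h : 2 ^ (m - 1) ≤ n) : (m : ℝ) ≤ 4 * Real.log n := by
  have h1 : ((2 : ℝ) ^ (m - 1)) ≤ n := by exact_mod_cast h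
  have h2 := Real.log_le_log (by positivity) h1
  rw [Real.log_pow, Nat.cast_sub (by omega), Nat.cast_one] at h2
  have h3 := Real.log_two_gt_d9
  have h4 : (2 : ℝ) ≤ m := by exact_mod_cast hm
  nlinarith

lemma log_two_add_one_le {m : ℕ} {x : ℝ} (hm : 2 ≤ m) (hmx : (m : ℝ) ≤ 4 * x)
    (hx : 3 ≤ Real.log x) : ((Nat.log 2 (2 * m) + 1 : ℕ) : ℝ) ≤ 5 * Real.log x := by
  have h1 : (2 : ℝ) ^ Nat.log 2 (2 * m) ≤ 2 * m := by
    exact_mod_cast Nat.pow_log_le_self 2 (by omega)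
  have h4 : (2 : ℝ) ≤ m := by exact_mod_cast hm
  have hx0 : 0 < x := by linarith
  have h2 := Real.log_le_log (by positivity) (h1.trans (by linarith : 2 * (m : ℝ) ≤ 2 ^ 3 * x))
  rw [Real.log_pow, Real.log_mul (by norm_num) hx0.ne', Real.log_pow] at h2
  have h3 := Real.log_two_gt_d9
  have h5 := Real.log_two_lt_d9
  have h6 : (0 : ℝ) ≤ Nat.log 2 (2 * m) := Nat.cast_nonneg _
  push_cast at *
  nlinarith

end Asymptotics

theorem statement_19 (k : ℕ) (hk : 1 ≤ k) :
    ∃ C : ℝ, 0 < C ∧ ∃ N : ℕ, ∀ n : ℕ, N ≤ n →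
      ∃ (V : Type) (U : SimpleGraph V), Finite V ∧
        (U.edgeSet.ncard : ℝ) ≤ C * k * n * Real.log n * Real.log (Real.log n) ∧
        ∀ G : SimpleGraph (Fin n), HasTreewidthLE G k → Contains U G := by

  have htend : Filter.Tendsto (fun n : ℕ => Real.log (Real.log n)) Filter.atTop Filter.atTop :=
    Real.tendsto_log_atTop.comp (Real.tendsto_log_atTop.comp tendsto_natCast_atTop_atTop)
  obtain ⟨N, hN⟩ := Filter.eventually_atTop.1 (htend.eventually_ge_atTop 3)
  refine ⟨320 * (k + 1) * (k + 5), by positivity, max N 3, fun n hn => ?_⟩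
  have hlog := hN n ((le_max_left _ _).trans hn)
  obtain ⟨m, hm, hnm, hmn, hpow⟩ := exists_depth ((le_max_right _ _).trans hn)
  have hmlog := depth_le_log hm hpow
  set w := Nat.log 2 (2 * m) + 1 with hw
  have hwlog : (w : ℝ) ≤ 5 * Real.log (Real.log n) := log_two_add_one_le hm hmlog hlog
  refine ⟨JVert ((k + 1) * w) (2 * m) m, JGraph ((k + 1) * w) (2 * m) m, inferInstance, ?_, ?_⟩
  · have hwm : w ≤ 2 * m := by
      have := Nat.log_lt_self 2 (show 2 * m ≠ 0 by omega)
      omega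
    have h1 : (JGraph ((k + 1) * w) (2 * m) m).edgeSet.ncard ≤
        4 * n * ((k + 1) * (k + 5) * 4 * (m * w)) := by
      refine (JGraph.ncard_edgeSet_le _ _ _).trans ?_
      have h2 : (2 * m) ^ 2 + m * ((k + 1) * w * ((k + 1) * w + 2 * m)) ≤
          m * ((k + 1) * (k + 5) * 4 * (m * w)) := by
        have e1 : 1 ≤ w := by omega
        have e2 : m ≤ m * w := Nat.le_mul_of_pos_right _ e1
        have e3 : (k + 1) * w + 2 * m ≤ (k + 2) * (2 * m) := by nlinarith
        calc (2 * m) ^ 2 + m * ((k + 1) * w * ((k + 1) * w + 2 * m))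
            ≤ 4 * (m * (m * w)) + m * ((k + 1) * w * ((k + 2) * (2 * m))) := by
              gcongr
              nlinarith
          _ = m * ((4 + 2 * (k + 1) * (k + 2)) * (m * w)) := by ring
          _ ≤ m * ((k + 1) * (k + 5) * 4 * (m * w)) := by
              gcongr
              nlinarith
      calc 2 ^ m * ((2 * m) ^ 2 + m * ((k + 1) * w * ((k + 1) * w + 2 * m)))
          ≤ 2 ^ m * (m * ((k + 1) * (k + 5) * 4 * (m * w))) := Nat.mul_le_mul_left _ h2
        _ = 2 ^ m * m * ((k + 1) * (k + 5) * 4 * (m * w)) := by ring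
        _ ≤ _ := Nat.mul_le_mul_right _ hmn
    have hk' : (1 : ℝ) ≤ k := by exact_mod_cast hk
    have hl : 0 ≤ Real.log n := Real.log_natCast_nonneg n
    calc ((JGraph ((k + 1) * w) (2 * m) m).edgeSet.ncard : ℝ)
        ≤ 4 * n * ((k + 1) * (k + 5) * 4 * (m * w)) := by exact_mod_cast h1
      _ ≤ 4 * n * ((k + 1) * (k + 5) * 4 *
            ((4 * Real.log n) * (5 * Real.log (Real.log n)))) := by gcongr
      _ = 320 * (k + 1) * (k + 5) * 1 * n * Real.log n * Real.log (Real.log n) := by ring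
      _ ≤ 320 * (k + 1) * (k + 5) * k * n * Real.log n * Real.log (Real.log n) := by gcongr
  · intro G hG
    have hbw : 2 * m ≤ 2 ^ w := (Nat.lt_pow_succ_log_self (by norm_num) _).le
    obtain ⟨f, hf, hadj⟩ := hG.exists_embedding (by omega : 0 < w) hbw (by omega) m (by omega)
      Finset.univ (by
        rw [Finset.card_univ, Fintype.card_fin, show 2 * m - m = m by omega]
        exact hnm)
    exact ⟨⟨f, fun h => hadj _ (Finset.mem_univ _) _ (Finset.mem_univ _) h⟩,
      fun u v h => hf (Finset.mem_coe.2 (Finset.mem_univ _)) (Finset.mem_coe.2 (Finset.mem_univ _)) h⟩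
end
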